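/- For any two skew shapes λ/μ and ν/ρ (partitions with at most k parts, μ ⊆ λ and ρ ⊆ ν) such that all parts of λ+ν and all parts of μ+ρ are even, the symmetric function (s_{((λ+ν)/2)/((μ+ρ)/2)})² − s_{λ/μ}·s_{ν/ρ} is Schur nonnegative (Okounkov's conjecture). -/

import Mathlib

/-- The complete homogeneous symmetric function `h_m` in `N` variables,
with `h_m = 0` for `m < 0`. -/
noncomputable def homog (N : ℕ) (m : ℤ) : MvPolynomial (Fin N) ℤ :=
  if 0 ≤ m then MvPolynomial.hsymm (Fin N) ℤ m.toNat else 0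

/-- The skew Schur polynomial `s_{λ/μ}` in `N` variables, given by the
Jacobi–Trudi determinant `det (h_{λ_i - μ_j - i + j})_{i,j=1}^k`, where the
partitions `lam`, `mu` are recorded 0-indexed (`lam 0 = λ_1`). -/
noncomputable def skewSchur (N k : ℕ) (lam mu : ℕ → ℕ) : MvPolynomial (Fin N) ℤ :=
  Matrix.det (Matrix.of fun i j : Fin k =>
    homog N ((lam i : ℤ) - (mu j : ℤ) - (i : ℤ) + (j : ℤ)))

/-- A symmetric polynomial is Schur nonnegative if it is a linear combination
with nonnegative coefficients of Schur polynomials `s_λ`. -/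
def IsSchurNonneg (N : ℕ) (f : MvPolynomial (Fin N) ℤ) : Prop :=
  ∃ (m : ℕ) (c : Fin m → ℕ) (k : Fin m → ℕ) (lam : Fin m → ℕ → ℕ),
    (∀ i, Antitone (lam i)) ∧ (∀ i j, k i ≤ j → lam i j = 0) ∧
    f = ∑ i, (c i : ℤ) • skewSchur N (k i) (lam i) (fun _ => 0)


namespace Okounkov

open Finset

section HH
variable {R : Type*} [CommRing R]

/-- complete homogeneous polynomials in the first `m` of a sequence of elements -/
def hh (x : ℕ → R) : ℕ → ℕ → R
  | 0, 0 => 1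
  | 0, _ + 1 => 0
  | _ + 1, 0 => 1
  | m + 1, n + 1 => hh x m (n + 1) + x m * hh x (m + 1) n
termination_by m n => (m, n)

/-- the same, integer indexed -/
def hz (x : ℕ → R) (m : ℕ) (n : ℤ) : R := if 0 ≤ n then hh x m n.toNat else 0

theorem hh_zero_right (x : ℕ → R) (m : ℕ) : hh x m 0 = 1 := by
  cases m <;> simp [hh]

theorem hz_neg (x : ℕ → R) (m : ℕ) {n : ℤ} (h : n < 0) : hz x m n = 0 := by
  simp [hz, not_le.mpr h]

theorem hz_zero (x : ℕ → R) (m : ℕ) : hz x m 0 = 1 := by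
  simp [hz, hh_zero_right]

theorem hz_base (x : ℕ → R) (n : ℤ) : hz x 0 n = if n = 0 then 1 else 0 := by
  rcases lt_trichotomy n 0 with h | h | h
  · rw [hz_neg _ _ h, if_neg (by omega)]
  · simp [h, hz_zero]
  · rw [if_neg (by omega), hz, if_pos (by omega)]
    obtain ⟨k, hk⟩ : ∃ k, n.toNat = k + 1 := ⟨n.toNat - 1, by omega⟩
    rw [hk, hh]

theorem hz_succ (x : ℕ → R) (m : ℕ) (n : ℤ) :
    hz x (m + 1) n = hz x m n + x m * hz x (m + 1) (n - 1) := by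
  rcases lt_trichotomy n 0 with h | h | h
  · rw [hz_neg _ _ h, hz_neg _ _ h, hz_neg _ _ (by omega)]; simp
  · subst h; rw [hz_zero, hz_zero, hz_neg _ _ (by omega)]; simp
  · obtain ⟨k, hk⟩ : ∃ k, n.toNat = k + 1 := ⟨n.toNat - 1, by omega⟩
    have hk' : (n - 1).toNat = k := by omega
    rw [hz, hz, hz, if_pos (by omega), if_pos (by omega), if_pos (by omega), hk, hk', hh]

/-- hsymm evaluated -/
def hs (σ : Type*) [Fintype σ] [DecidableEq σ] (x : σ → R) (n : ℕ) : R :=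
  ∑ s : Sym σ n, (s.1.map x).prod

theorem hs_zero (σ : Type*) [Fintype σ] [DecidableEq σ] (x : σ → R) : hs σ x 0 = 1 := by
  simp [hs]
  rfl

theorem hs_option (σ : Type*) [Fintype σ] [DecidableEq σ] (x : Option σ → R) (n : ℕ) :
    hs (Option σ) x (n + 1) = hs σ (fun a => x (some a)) (n + 1) + x none * hs (Option σ) x n := by
  unfold hs
  rw [← Equiv.sum_comp (symOptionSuccEquiv (α := σ) (n := n)).symm, Fintype.sum_sum_type,
    add_comm, mul_sum]
  congr 1
  · refine sum_congr rfl fun s _ => ?_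
    change Multiset.prod (Multiset.map x (Multiset.map _ s.1)) = _
    rw [Multiset.map_map]; rfl
  · refine sum_congr rfl fun s _ => ?_
    change Multiset.prod (Multiset.map x (none ::ₘ s.1)) = _
    simp

theorem hs_equiv {σ τ : Type*} [Fintype σ] [DecidableEq σ] [Fintype τ] [DecidableEq τ]
    (e : σ ≃ τ) (x : τ → R) (n : ℕ) : hs σ (fun a => x (e a)) n = hs τ x n := by
  unfold hs
  rw [← Equiv.sum_comp (Sym.equivCongr e (n := n))]
  refine sum_congr rfl fun s _ => ?_
  change _ = Multiset.prod (Multiset.map x (Multiset.map _ s.1))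
  rw [Multiset.map_map]; rfl

theorem hs_fin (x : ℕ → R) (m n : ℕ) : hs (Fin m) (fun i => x i) n = hh x m n := by
  induction m generalizing n with
  | zero =>
    cases n with
    | zero => rw [hs_zero, hh]
    | succ n =>
      rw [hh, hs]
      apply Fintype.sum_empty
  | succ m ih =>
    induction n with
    | zero => rw [hs_zero, hh]
    | succ n ihn =>
      rw [hh, ← ih, ← ihn]
      have e := fun n => hs_equiv (R := R) (finSuccEquivLast (n := m))
        (fun o => x ((finSuccEquivLast (n := m)).symm o)) n
      simp only [Equiv.symm_apply_apply] at e
      rw [e, e, hs_option]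
      simp

end HH

/-- the variables as a sequence -/
noncomputable def xx (N : ℕ) (i : ℕ) : MvPolynomial (Fin N) ℤ :=
  if h : i < N then MvPolynomial.X ⟨i, h⟩ else 0

theorem xx_fin (N : ℕ) (i : Fin N) : xx N i = MvPolynomial.X i := by
  simp [xx]

theorem homog_eq (N : ℕ) (m : ℤ) : homog N m = hz (xx N) N m := by
  unfold homog hz
  split_ifs with h
  · rw [← hs_fin]
    simp only [xx_fin]
    rfl
  · rfl

end Okounkov


namespace Okounkov

open Finset

section GF
variable {R : Type*} [CommRing R]

theorem gf_succ (x : ℕ → R) (m : ℕ) :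
    PowerSeries.mk (hh x (m + 1)) * (1 - PowerSeries.C (x m) * PowerSeries.X)
      = PowerSeries.mk (hh x m) := by
  ext n
  rw [mul_sub, mul_one, ← mul_assoc, mul_comm _ (PowerSeries.C (x m)), mul_assoc]
  cases n with
  | zero => simp [hh_zero_right]
  | succ n =>
    rw [map_sub, PowerSeries.coeff_C_mul, PowerSeries.coeff_succ_mul_X]
    simp only [PowerSeries.coeff_mk]
    rw [hh]; ring

theorem gf (x : ℕ → R) (m : ℕ) :
    PowerSeries.mk (hh x m) * ∏ i ∈ range m, (1 - PowerSeries.C (x i) * PowerSeries.X) = 1 := by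
  induction m with
  | zero =>
    ext n
    cases n <;> simp [hh, PowerSeries.coeff_one]
  | succ m ih =>
    rw [prod_range_succ, mul_comm (∏ i ∈ range m, _), ← mul_assoc, gf_succ, ih]

theorem geom_ps (a : R) :
    PowerSeries.mk (fun n => a ^ n) * (1 - PowerSeries.C a * PowerSeries.X) = 1 := by
  ext n
  rw [mul_sub, mul_one, ← mul_assoc, mul_comm _ (PowerSeries.C a), mul_assoc]
  cases n with
  | zero => simp
  | succ n =>
    rw [map_sub, PowerSeries.coeff_C_mul, PowerSeries.coeff_succ_mul_X]
    simp only [PowerSeries.coeff_mk]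
    rw [PowerSeries.coeff_one, if_neg (by omega)]; ring

/-- the partial elementary polynomial -/
noncomputable def epol (x : ℕ → R) (m l : ℕ) : Polynomial R :=
  ∏ i ∈ (range m).erase l, (1 - Polynomial.C (x i) * Polynomial.X)

theorem epol_deg (x : ℕ → R) (m l : ℕ) (hl : l < m) (r : ℕ) (hr : m ≤ r) :
    (epol x m l).coeff r = 0 := by
  apply Polynomial.coeff_eq_zero_of_natDegree_lt
  have : (epol x m l).natDegree ≤ ∑ i ∈ (range m).erase l, 1 := by
    refine (Polynomial.natDegree_prod_le _ _).trans (sum_le_sum fun i _ => ?_)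
    refine (Polynomial.natDegree_sub_le _ _).trans ?_
    simp only [Polynomial.natDegree_one]
    exact max_le (by omega) ((Polynomial.natDegree_C_mul_le _ _).trans Polynomial.natDegree_X_le)
  have h2 : ((range m).erase l).card = m - 1 := by
    rw [card_erase_of_mem (by simpa using hl), card_range]
  simp only [sum_const, smul_eq_mul, mul_one, h2] at this
  omega

theorem epol_ps (x : ℕ → R) (m l : ℕ) (hl : l < m) :
    PowerSeries.mk (hh x m) * (epol x m l : PowerSeries R) = PowerSeries.mk (fun n => x l ^ n) := by
  have h1 := gf x m
  rw [← mul_prod_erase _ _ (mem_range.mpr hl)] at h1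
  have h2 : (epol x m l : PowerSeries R)
      = ∏ i ∈ (range m).erase l, (1 - PowerSeries.C (x i) * PowerSeries.X) := by
    unfold epol
    rw [← Polynomial.coeToPowerSeries.ringHom_apply, map_prod]
    refine prod_congr rfl fun i _ => ?_
    simp
  rw [← h2, mul_comm (1 - _), ← mul_assoc] at h1
  have h3 := geom_ps (x l)
  rw [mul_comm] at h3
  exact left_inv_eq_right_inv h1 h3

theorem hz_epol (x : ℕ → R) (m l : ℕ) (hl : l < m) (n : ℕ) :
    ∑ r ∈ range m, hz x m ((n : ℤ) - r) * (epol x m l).coeff r = x l ^ n := by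
  have h := congrArg (PowerSeries.coeff n) (epol_ps x m l hl)
  rw [mul_comm, PowerSeries.coeff_mul, Finset.Nat.sum_antidiagonal_eq_sum_range_succ_mk] at h
  simp only [PowerSeries.coeff_mk, Polynomial.coeff_coe] at h
  rw [← h]
  have e1 : ∑ r ∈ range m, hz x m ((n : ℤ) - r) * (epol x m l).coeff r
      = ∑ r ∈ range (max m (n + 1)), hz x m ((n : ℤ) - r) * (epol x m l).coeff r := by
    apply sum_subset (range_mono (le_max_left _ _))
    intro r _ hr
    rw [epol_deg x m l hl r (by simpa using hr), mul_zero]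
  have e2 : ∑ r ∈ range (n + 1), hz x m ((n : ℤ) - r) * (epol x m l).coeff r
      = ∑ r ∈ range (max m (n + 1)), hz x m ((n : ℤ) - r) * (epol x m l).coeff r := by
    apply sum_subset (range_mono (le_max_right _ _))
    intro r _ hr
    simp only [mem_range, not_lt] at hr
    rw [hz_neg _ _ (by omega), zero_mul]
  rw [e1, ← e2]
  refine sum_congr rfl fun r hr => ?_
  simp only [mem_range] at hr
  rw [hz, if_pos (by omega), mul_comm]
  congr 2
  omega

end GF

/-- Jacobi–Trudi determinant for an arbitrary integer vector -/
noncomputable def sdet (N : ℕ) (α : Fin N → ℤ) : MvPolynomial (Fin N) ℤ :=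
  Matrix.det (Matrix.of fun i j : Fin N => hz (xx N) N (α i - (i : ℤ) + (j : ℤ)))

/-- alternant -/
noncomputable def alt (N : ℕ) (γ : Fin N → ℕ) : MvPolynomial (Fin N) ℤ :=
  Matrix.det (Matrix.of fun i l : Fin N => (MvPolynomial.X l : MvPolynomial (Fin N) ℤ) ^ γ i)

/-- matrix of partial elementary polynomials -/
noncomputable def epsM (N : ℕ) : Matrix (Fin N) (Fin N) (MvPolynomial (Fin N) ℤ) :=
  Matrix.of fun j l => (epol (xx N) N l).coeff (N - 1 - j)

theorem sdet_mul_eps (N : ℕ) (α : Fin N → ℕ) :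
    sdet N (fun i => (α i : ℤ)) * (epsM N).det = alt N (fun i => α i + (N - 1 - i)) := by
  unfold sdet alt
  rw [← Matrix.det_mul]
  congr 1
  ext1 i l
  rw [Matrix.mul_apply, Matrix.of_apply, ← xx_fin, ← hz_epol (xx N) N l l.2,
    ← Fin.sum_univ_eq_sum_range (fun r => hz (xx N) N (((α i + (N - 1 - i) : ℕ) : ℤ) - r) *
      (epol (xx N) N l).coeff r) N, ← Equiv.sum_comp Fin.revPerm]
  refine sum_congr rfl fun j _ => ?_
  simp only [epsM, Matrix.of_apply, Fin.revPerm_apply, Fin.val_rev]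
  have := i.2
  have := j.2
  congr 2
  · omega
  · omega

theorem sdet_zero (N : ℕ) : sdet N (fun _ => 0) = 1 := by
  unfold sdet
  rw [Matrix.det_of_isUpperTriangular]
  · simp [hz_zero]
  · intro i j hij
    simp only [id] at hij
    have : (j : ℕ) < i := hij
    simp only [Matrix.of_apply]
    exact hz_neg _ _ (by omega)

theorem alt_delta_ne (N : ℕ) : alt N (fun i => N - 1 - i) ≠ 0 := by
  have : alt N (fun i => N - 1 - i)
      = ((Matrix.vandermonde (fun l : Fin N => (MvPolynomial.X l : MvPolynomial (Fin N) ℤ))).transpose.submatrix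
        Fin.revPerm id).det := by
    unfold alt
    congr 1
    ext1 i l
    simp only [Matrix.of_apply, Matrix.submatrix_apply, Matrix.transpose_apply,
      Matrix.vandermonde_apply, Fin.revPerm_apply, Fin.val_rev, id]
    congr 1
    omega
  rw [this, Matrix.det_permute, Matrix.det_transpose]
  refine mul_ne_zero ?_ ?_
  · rcases Int.units_eq_one_or (Equiv.Perm.sign (Fin.revPerm : Equiv.Perm (Fin N))) with h | h <;>
      simp [h]
  · rw [Matrix.det_vandermonde_ne_zero_iff]
    exact MvPolynomial.X_injective

theorem sdet_mul_alt (N : ℕ) (α : Fin N → ℕ) :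
    sdet N (fun i => (α i : ℤ)) * alt N (fun i => N - 1 - i)
      = alt N (fun i => α i + (N - 1 - i)) := by
  have h := sdet_mul_eps N (fun _ => 0)
  simp only [Nat.cast_zero, sdet_zero, one_mul, zero_add] at h
  rw [← h, sdet_mul_eps]

theorem alt_eq (N : ℕ) (γ : Fin N → ℕ) :
    alt N γ = ∑ w : Equiv.Perm (Fin N), (Equiv.Perm.sign w : ℤ) •
      MvPolynomial.rename w (∏ i, (MvPolynomial.X i : MvPolynomial (Fin N) ℤ) ^ γ i) := by
  unfold alt
  rw [← Matrix.det_transpose, Matrix.det_apply]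
  refine sum_congr rfl fun w _ => ?_
  simp [Units.smul_def]

theorem expand {ι : Type*} (N : ℕ) (S : Finset ι) (w : ι → Fin N → ℕ)
    (F : MvPolynomial (Fin N) ℤ) (hF : F.IsSymmetric)
    (h : F = ∑ c ∈ S, ∏ i, (MvPolynomial.X i : MvPolynomial (Fin N) ℤ) ^ w c i) :
    F = ∑ c ∈ S, sdet N (fun i => (w c i : ℤ)) := by
  apply mul_right_cancel₀ (alt_delta_ne N)
  rw [sum_mul]
  simp only [sdet_mul_alt]
  rw [alt_eq, mul_sum]
  have : ∀ c, alt N (fun i => w c i + (N - 1 - i)) = ∑ u : Equiv.Perm (Fin N),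
      (Equiv.Perm.sign u : ℤ) • (MvPolynomial.rename u
        (∏ i, (MvPolynomial.X i : MvPolynomial (Fin N) ℤ) ^ w c i) * MvPolynomial.rename u
        (∏ i, (MvPolynomial.X i : MvPolynomial (Fin N) ℤ) ^ (N - 1 - (i : ℕ)))) := by
    intro c
    rw [alt_eq]
    simp only [← map_mul, ← prod_mul_distrib, ← pow_add]
  simp only [this]
  rw [sum_comm]
  refine sum_congr rfl fun u _ => ?_
  rw [← smul_sum, ← sum_mul, ← map_sum, ← h, hF u, mul_smul_comm]

theorem homog_symm (N : ℕ) (m : ℤ) : (homog N m).IsSymmetric := by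
  unfold homog
  split_ifs
  · exact MvPolynomial.hsymm_isSymmetric _ _ _
  · exact MvPolynomial.IsSymmetric.zero

theorem det_homog_symm (N k : ℕ) (f : Fin k → Fin k → ℤ) :
    (Matrix.det (Matrix.of fun i j => homog N (f i j))).IsSymmetric := by
  intro u
  rw [AlgHom.map_det]
  congr 1
  ext1 i j
  exact homog_symm N (f i j) u

theorem sdet_swap (N : ℕ) (α β : Fin N → ℤ) (p q : Fin N) (hq : (q : ℕ) = p + 1)
    (h1 : β p = α q - 1) (h2 : β q = α p + 1) (h3 : ∀ i, i ≠ p → i ≠ q → β i = α i) :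
    sdet N β = - sdet N α := by
  have hpq : p ≠ q := by intro h; rw [h] at hq; omega
  unfold sdet
  rw [← neg_one_mul (Matrix.det _)]
  have := Matrix.det_permute (Equiv.swap p q)
    (Matrix.of fun i j : Fin N => hz (xx N) N (α i - (i : ℤ) + (j : ℤ)))
  rw [Equiv.Perm.sign_swap hpq] at this
  simp only [Units.val_neg, Units.val_one, Int.cast_neg, Int.cast_one] at this
  rw [← this]
  congr 1
  ext1 i j
  simp only [Matrix.of_apply, Matrix.submatrix_apply, id]
  by_cases hip : i = p
  · subst hip
    rw [Equiv.swap_apply_left, h1]; congr 1; omega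
  · by_cases hiq : i = q
    · subst hiq
      rw [Equiv.swap_apply_right, h2]; congr 1; omega
    · rw [Equiv.swap_apply_of_ne_of_ne hip hiq, h3 i hip hiq]

end Okounkov


namespace Okounkov

open Finset

theorem cnt (n : ℕ) (P : ℕ → Prop) [DecidablePred P] (hP : ∀ c, c + 1 < n → P c → P (c + 1)) :
    ∀ c < n, (P c ↔ n ≤ c + #{c ∈ range n | P c}) := by
  classical
  have hex : ∃ t, n ≤ t ∨ P t := ⟨n, Or.inl le_rfl⟩
  set t := Nat.find hex with ht
  have htn : t ≤ n := Nat.find_min' hex (Or.inl le_rfl)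
  have key : ∀ c < n, (P c ↔ t ≤ c) := by
    intro c hc
    constructor
    · intro h; exact Nat.find_min' hex (Or.inr h)
    · intro h
      induction c, h using Nat.le_induction with
      | base =>
        rcases Nat.find_spec hex with h | h
        · omega
        · exact h
      | succ c _ ih => exact hP c hc (ih (by omega))
  have hf : {c ∈ range n | P c} = Ico t n := by
    ext c
    simp only [mem_filter, mem_range, mem_Ico]
    constructor
    · rintro ⟨h1, h2⟩; exact ⟨(key c h1).1 h2, h1⟩
    · rintro ⟨h1, h2⟩; exact ⟨h2, (key c h2).2 h1⟩
  intro c hc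
  rw [hf, Nat.card_Ico, key c hc]
  omega

/-- column functions -/
structure IsCol (k C : ℕ) (z : ℕ → ℤ) : Prop where
  mono : ∀ c, z c ≤ z (c + 1)
  nonneg : ∀ c, 0 ≤ z c
  out : ∀ c, C ≤ c → z c = k

theorem IsCol.le {k C : ℕ} {z : ℕ → ℤ} (h : IsCol k C z) (c : ℕ) : z c ≤ k := by
  have := monotone_nat_of_le_succ h.mono (le_max_left c C)
  rw [h.out _ (le_max_right c C)] at this
  exact this

/-- row lengths (reversed order) of a column function -/
def rows (k C : ℕ) (z : ℕ → ℤ) (i : ℕ) : ℕ := #{c ∈ range C | (k : ℤ) ≤ z c + i}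

/-- column function of row lengths -/
def cols (k C : ℕ) (κ : ℕ → ℕ) (c : ℕ) : ℤ := (#{i ∈ range k | C ≤ c + κ i} : ℕ)

/-- compatibility between row lengths and column functions -/
def Rel (k C : ℕ) (κ : ℕ → ℕ) (z : ℕ → ℤ) : Prop :=
  ∀ c < C, ∀ i < k, (C ≤ c + κ i ↔ (k : ℤ) ≤ z c + i)

theorem rows_rel {k C : ℕ} {z : ℕ → ℤ} (h : IsCol k C z) : Rel k C (rows k C z) z := by
  intro c hc i _
  exact (cnt C (fun c => (k : ℤ) ≤ z c + i) (fun c _ hh => by have := h.mono c; omega) c hc).symm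

theorem cols_rel {k C : ℕ} {κ : ℕ → ℕ} (h : ∀ i, i + 1 < k → κ i ≤ κ (i + 1)) :
    Rel k C κ (cols k C κ) := by
  intro c _ i hi
  have := cnt k (fun i => C ≤ c + κ i) (fun i hi' hh => by have := h i hi'; omega) i hi
  rw [this]
  unfold cols
  omega

theorem rows_le (k C : ℕ) (z : ℕ → ℤ) (i : ℕ) : rows k C z i ≤ C := by
  unfold rows
  exact (card_filter_le _ _).trans (by simp)

theorem rows_mono (k C : ℕ) (z : ℕ → ℤ) (i : ℕ) : rows k C z i ≤ rows k C z (i + 1) := by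
  unfold rows
  apply card_le_card
  intro c
  simp only [mem_filter]
  rintro ⟨h1, h2⟩
  exact ⟨h1, by push_cast; omega⟩

theorem cols_isCol (k C : ℕ) (κ : ℕ → ℕ) : IsCol k C (cols k C κ) where
  mono c := by
    unfold cols
    have : #{i ∈ range k | C ≤ c + κ i} ≤ #{i ∈ range k | C ≤ c + 1 + κ i} := by
      apply card_le_card
      intro c
      simp only [mem_filter]
      rintro ⟨h1, h2⟩
      exact ⟨h1, by omega⟩
    omega
  nonneg c := by unfold cols; omega
  out c hc := by
    unfold cols
    rw [filter_true_of_mem (fun i _ => by omega)]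
    simp

theorem rel_le_z {k C : ℕ} {κ κ' : ℕ → ℕ} {z z' : ℕ → ℤ} (h : Rel k C κ z) (h' : Rel k C κ' z')
    (hz : IsCol k C z) (hz' : IsCol k C z') (hle : ∀ i < k, κ i ≤ κ' i) (c : ℕ) : z c ≤ z' c := by
  by_cases hc : c < C
  · by_contra hlt
    have h0 := hz'.nonneg c
    have h1 := hz.le c
    obtain ⟨i, hi⟩ : ∃ i : ℕ, (i : ℤ) = k - z c := ⟨(k - z c).toNat, by omega⟩
    have e1 := h c hc i (by omega)
    have e2 := h' c hc i (by omega)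
    have := hle i (by omega)
    omega
  · rw [hz.out c (by omega), hz'.out c (by omega)]

theorem rel_le_k {k C : ℕ} {κ κ' : ℕ → ℕ} {z z' : ℕ → ℤ} (h : Rel k C κ z) (h' : Rel k C κ' z')
    (hk : ∀ i < k, κ i ≤ C) (hle : ∀ c < C, z c ≤ z' c) (i : ℕ) (hi : i < k) : κ i ≤ κ' i := by
  by_contra hlt
  have := hk i hi
  have e1 := h (C - κ i) (by omega) i (by omega)
  have e2 := h' (C - κ i) (by omega) i (by omega)
  have := hle (C - κ i) (by omega)
  omega

theorem rel_int_z {k C : ℕ} {κ κ' : ℕ → ℕ} {z z' : ℕ → ℤ} (h : Rel k C κ z) (h' : Rel k C κ' z')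
    (hz : IsCol k C z) (hz' : IsCol k C z') (hle : ∀ i, i + 1 < k → κ i ≤ κ' (i + 1)) (c : ℕ) :
    z c ≤ z' c + 1 := by
  by_cases hc : c < C
  · by_contra hlt
    have h0 := hz'.nonneg c
    have h1 := hz.le c
    obtain ⟨i, hi⟩ : ∃ i : ℕ, (i : ℤ) = k - z c := ⟨(k - z c).toNat, by omega⟩
    have e1 := h c hc i (by omega)
    have e2 := h' c hc (i + 1) (by omega)
    have := hle i (by omega)
    omega
  · rw [hz.out c (by omega), hz'.out c (by omega)]; omega

theorem rel_int_k {k C : ℕ} {κ κ' : ℕ → ℕ} {z z' : ℕ → ℤ} (h : Rel k C κ z) (h' : Rel k C κ' z')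
    (hk : ∀ i < k, κ i ≤ C) (hle : ∀ c < C, z c ≤ z' c + 1) (i : ℕ) (hi : i + 1 < k) :
    κ i ≤ κ' (i + 1) := by
  by_contra hlt
  have := hk i (by omega)
  have e1 := h (C - κ i) (by omega) i (by omega)
  have e2 := h' (C - κ i) (by omega) (i + 1) (by omega)
  have := hle (C - κ i) (by omega)
  omega

theorem rel_sum {k C : ℕ} {κ : ℕ → ℕ} {z : ℕ → ℤ} (h : Rel k C κ z) (hz : IsCol k C z)
    (hk : ∀ i < k, κ i ≤ C) : ∑ c ∈ range C, z c = ((∑ i ∈ range k, κ i : ℕ) : ℤ) := by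
  have h1 : ∀ c ∈ range C, z c = ∑ i ∈ range k, if C ≤ c + κ i then (1 : ℤ) else 0 := by
    intro c hc
    rw [mem_range] at hc
    rw [sum_boole]
    obtain ⟨t, ht⟩ : ∃ t : ℕ, (t : ℤ) = k - z c := ⟨(k - z c).toNat, by
      have := hz.le c; omega⟩
    have : {i ∈ range k | C ≤ c + κ i} = Ico t k := by
      ext i
      simp only [mem_filter, mem_range, mem_Ico]
      constructor
      · rintro ⟨h1, h2⟩
        have := (h c hc i h1).1 h2
        omega
      · rintro ⟨h1, h2⟩
        exact ⟨h2, (h c hc i h2).2 (by omega)⟩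
    rw [this, Nat.card_Ico]
    have := hz.nonneg c
    omega
  rw [sum_congr rfl h1, sum_comm]
  push_cast
  refine sum_congr rfl fun i hi => ?_
  rw [mem_range] at hi
  rw [sum_boole]
  have : {c ∈ range C | C ≤ c + κ i} = Ico (C - κ i) C := by
    ext c
    simp only [mem_filter, mem_range, mem_Ico]
    have := hk i hi
    omega
  rw [this, Nat.card_Ico]
  have := hk i hi
  omega

end Okounkov


namespace Okounkov

open Finset

section
variable {R : Type*} [CommRing R]

theorem hz_iter (x : ℕ → R) (m : ℕ) (lo : ℕ) (s : ℤ) (a : ℕ) (h : lo ≤ a) :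
    hz x (m + 1) (a + s) = ∑ q ∈ Icc lo a, x m ^ (a - q) * hz x m (q + s)
      + x m ^ (a + 1 - lo) * hz x (m + 1) (lo + s - 1) := by
  induction a, h using Nat.le_induction with
  | base =>
    rw [hz_succ]; simp
  | succ a hla ih =>
    rw [hz_succ, sum_Icc_succ_top (by omega)]
    have e : ((a + 1 : ℕ) : ℤ) + s - 1 = a + s := by push_cast; ring
    rw [e, ih, mul_add, mul_sum, Nat.sub_self, pow_zero, one_mul,
      show a + 1 + 1 - lo = (a + 1 - lo) + 1 by omega, pow_succ']
    have : ∑ q ∈ Icc lo a, x m ^ (a + 1 - q) * hz x m (q + s)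
        = ∑ q ∈ Icc lo a, x m * (x m ^ (a - q) * hz x m (q + s)) := by
      refine sum_congr rfl fun q hq => ?_
      rw [mem_Icc] at hq
      rw [show a + 1 - q = (a - q) + 1 by omega, pow_succ']; ring
    rw [this]; ring

/-- lower bounds for interlacing -/
def lo (α : ℕ → ℕ) (i : ℕ) : ℕ := if i = 0 then 0 else α (i - 1)

theorem det_step (x : ℕ → R) (m K : ℕ) (α b : ℕ → ℕ) (hα : ∀ i, i < K → α i ≤ α (i + 1)) :
    Matrix.det (Matrix.of fun i j : Fin (K + 1) =>
        hz x (m + 1) ((α i : ℤ) + ((i : ℤ) - (b j : ℤ))))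
    = ∑ κ ∈ Fintype.piFinset (fun i : Fin (K + 1) => Icc (lo α i) (α i)),
        (∏ i : Fin (K + 1), x m ^ (α i - κ i)) * Matrix.det (Matrix.of fun i j : Fin (K + 1) =>
          hz x m ((κ i : ℤ) + ((i : ℤ) - (b j : ℤ)))) := by
  have hlo : ∀ i : Fin (K + 1), lo α i ≤ α i := by
    intro i
    unfold lo
    split_ifs with h
    · omega
    · have := hα (i - 1) (by omega)
      rwa [show (i : ℕ) - 1 + 1 = i by omega] at this
  rw [Matrix.det_eq_of_forall_row_eq_smul_add_pred
    (B := fun i => ∑ q ∈ Icc (lo α i) (α i),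
      x m ^ (α i - q) • (fun j : Fin (K + 1) => hz x m ((q : ℤ) + ((i : ℤ) - (b j : ℤ)))))
    (fun i : Fin K => x m ^ (α (i + 1) + 1 - α i))]
  · have := (Matrix.detRowAlternating (n := Fin (K + 1)) (R := R)).toMultilinearMap.map_sum_finset
      (fun i q => x m ^ (α i - q) • (fun j : Fin (K + 1) => hz x m ((q : ℤ) + ((i : ℤ) - (b j : ℤ)))))
      (fun i : Fin (K + 1) => Icc (lo α i) (α i))
    refine Eq.trans this ?_
    refine sum_congr rfl fun κ _ => ?_
    rw [MultilinearMap.map_smul_univ]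
    rfl
  · intro j
    simp only [Matrix.of_apply, Finset.sum_apply, Pi.smul_apply, smul_eq_mul]
    rw [hz_iter x m (lo α (0 : Fin (K + 1))) _ (α (0 : Fin (K + 1))) (hlo 0)]
    rw [hz_neg x (m + 1) (n := (lo α (0 : Fin (K + 1)) : ℤ) + _ - 1)]
    · simp
    · simp [lo]; omega
  · intro i j
    simp only [Matrix.of_apply, Finset.sum_apply, Pi.smul_apply, smul_eq_mul]
    rw [hz_iter x m (lo α i.succ) _ (α i.succ) (hlo i.succ)]
    have : lo α i.succ = α i := by simp [lo]
    rw [this]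
    simp only [Fin.val_succ, Fin.val_castSucc]
    congr 3
    push_cast; ring

theorem det_base (x : ℕ → R) (K : ℕ) (α β : ℕ → ℕ)
    (hα : ∀ i, i + 1 < K → α i ≤ α (i + 1)) (hβ : ∀ i, i + 1 < K → β i ≤ β (i + 1)) :
    Matrix.det (Matrix.of fun i j : Fin K => hz x 0 ((α i : ℤ) + ((i : ℤ) - ((β j + j : ℕ) : ℤ))))
      = if (∀ i < K, α i = β i) then 1 else 0 := by
  have hst : ∀ γ : ℕ → ℕ, (∀ i, i + 1 < K → γ i ≤ γ (i + 1)) →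
      StrictMono (fun i : Fin K => γ i + i) := by
    intro γ hγ
    have : ∀ j : ℕ, j < K → ∀ i ≤ j, γ i ≤ γ j := by
      intro j
      induction j with
      | zero => intro _ i hi; rw [Nat.le_zero.mp hi]
      | succ j ih =>
        intro hj i hi
        rcases Nat.le_succ_iff.mp hi with h | h
        · exact (ih (by omega) i h).trans (hγ j hj)
        · rw [h]
    intro i j hij
    have := this j j.2 i (le_of_lt hij)
    have h2 : (i : ℕ) < j := hij
    simp only
    omega
  split_ifs with h
  · have : (Matrix.of fun i j : Fin K => hz x 0 ((α i : ℤ) + ((i : ℤ) - ((β j + j : ℕ) : ℤ)))) = 1 := by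
      ext1 i j
      rw [Matrix.of_apply, hz_base, Matrix.one_apply]
      congr 1
      rw [h i i.2]
      have := (hst β hβ).injective.eq_iff (a := i) (b := j)
      rw [eq_iff_iff, ← this]
      push_cast
      omega
    rw [this, Matrix.det_one]
  · rw [Matrix.det_apply]
    apply sum_eq_zero
    intro σ _
    by_cases hσ : ∀ i, α (σ i) + (σ i : ℕ) = β i + i
    · exfalso
      apply h
      have h1 : (fun i : Fin K => α i + (i : ℕ)) ∘ σ = fun i : Fin K => β i + i := funext hσ
      have h2 := ((hst α hα).range_inj (hst β hβ)).1 (by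
        rw [← h1, Set.range_comp, σ.surjective.range_eq, Set.image_univ])
      intro i hi
      have := congrFun h2 ⟨i, hi⟩
      simpa using this
    · push Not at hσ
      obtain ⟨i, hi⟩ := hσ
      rw [prod_eq_zero (mem_univ i), smul_zero]
      rw [Matrix.of_apply, hz_base, if_neg]
      push_cast
      omega

end

end Okounkov


namespace Okounkov

open Finset

/-- skew tableaux recorded by column functions -/
structure Tab (N : ℕ) (bot top : ℕ → ℤ) (y : ℕ → ℕ → ℤ) : Prop where
  mono : ∀ m c, y m c ≤ y m (c + 1)
  up : ∀ m c, y m c ≤ y (m + 1) c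
  up1 : ∀ m c, y (m + 1) c ≤ y m c + 1
  bot : ∀ c, y 0 c = bot c
  top : ∀ m, N ≤ m → ∀ c, y m c = top c

section
variable {R : Type*} [CommRing R]

/-- Jacobi–Trudi determinant of a column function -/
def Dt (x : ℕ → R) (m k C : ℕ) (b : ℕ → ℕ) (z : ℕ → ℤ) : R :=
  Matrix.det (Matrix.of fun i j : Fin k => hz x m ((rows k C z i : ℤ) + ((i : ℤ) - (b j : ℤ))))

/-- extension of a finite sequence by zero -/
def extz {k : ℕ} (κ : Fin k → ℕ) (i : ℕ) : ℕ := if h : i < k then κ ⟨i, h⟩ else 0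

theorem extz_fin {k : ℕ} (κ : Fin k → ℕ) (i : Fin k) : extz κ i = κ i := by simp [extz]

theorem rel_unique {k C : ℕ} {κ κ' : ℕ → ℕ} {z : ℕ → ℤ} (h : Rel k C κ z) (h' : Rel k C κ' z)
    (hk : ∀ i < k, κ i ≤ C) (hk' : ∀ i < k, κ' i ≤ C) (i : ℕ) (hi : i < k) : κ i = κ' i :=
  le_antisymm (rel_le_k h h' hk (fun _ _ => le_rfl) i hi) (rel_le_k h' h hk' (fun _ _ => le_rfl) i hi)

theorem rel_unique_z {k C : ℕ} {κ : ℕ → ℕ} {z z' : ℕ → ℤ} (h : Rel k C κ z) (h' : Rel k C κ z')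
    (hz : IsCol k C z) (hz' : IsCol k C z') : z = z' :=
  funext fun c => le_antisymm (rel_le_z h h' hz hz' (fun _ _ => le_rfl) c)
    (rel_le_z h' h hz' hz (fun _ _ => le_rfl) c)

theorem step_cols (x : ℕ → R) (m K C : ℕ) (b : ℕ → ℕ) (z : ℕ → ℤ) (hz : IsCol (K + 1) C z) :
    ∃ S : Finset (ℕ → ℤ),
      (∀ z', z' ∈ S ↔ IsCol (K + 1) C z' ∧ ∀ c, z' c ≤ z c ∧ z c ≤ z' c + 1) ∧
      Dt x (m + 1) (K + 1) C b z = ∑ z' ∈ S,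
        x m ^ (∑ c ∈ range C, (z c - z' c)).toNat * Dt x m (K + 1) C b z' := by
  classical
  set α := rows (K + 1) C z with hα
  have hrel : Rel (K + 1) C α z := rows_rel hz
  have hαC : ∀ i, α i ≤ C := rows_le _ _ _
  set P := Fintype.piFinset (fun i : Fin (K + 1) => Icc (lo α i) (α i)) with hP
  have p1 : ∀ κ ∈ P, ∀ i < K + 1, lo α i ≤ extz κ i ∧ extz κ i ≤ α i := by
    intro κ hκ i hi
    have := (Fintype.mem_piFinset.1 hκ) ⟨i, hi⟩
    simpa [extz, hi] using this
  have p2 : ∀ κ ∈ P, Rel (K + 1) C (extz κ) (cols (K + 1) C (extz κ)) := by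
    intro κ hκ
    apply cols_rel
    intro i hi
    have h1 := (p1 κ hκ i (by omega)).2
    have h2 := (p1 κ hκ (i + 1) hi).1
    simp only [lo, Nat.add_sub_cancel] at h2
    rw [if_neg (by omega)] at h2
    omega
  have p3 : ∀ κ ∈ P, ∀ i < K + 1, extz κ i ≤ C := fun κ hκ i hi => (p1 κ hκ i hi).2.trans (hαC i)
  have p4 : ∀ κ ∈ P, ∀ i < K + 1, rows (K + 1) C (cols (K + 1) C (extz κ)) i = extz κ i := by
    intro κ hκ
    exact rel_unique (rows_rel (cols_isCol _ _ _)) (p2 κ hκ) (fun i _ => rows_le _ _ _ i) (p3 κ hκ)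
  refine ⟨P.image (fun κ => cols (K + 1) C (extz κ)), ?_, ?_⟩
  · intro z'
    rw [mem_image]
    constructor
    · rintro ⟨κ, hκ, rfl⟩
      refine ⟨cols_isCol _ _ _, fun c => ⟨?_, ?_⟩⟩
      · exact rel_le_z (p2 κ hκ) hrel (cols_isCol _ _ _) hz (fun i hi => (p1 κ hκ i hi).2) c
      · refine rel_int_z hrel (p2 κ hκ) hz (cols_isCol _ _ _) (fun i hi => ?_) c
        have h2 := (p1 κ hκ (i + 1) hi).1
        simp only [lo, Nat.add_sub_cancel] at h2
        rwa [if_neg (by omega)] at h2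
    · rintro ⟨h1, h2⟩
      have hr := rows_rel h1
      have he : ∀ i < K + 1, extz (fun i : Fin (K + 1) => rows (K + 1) C z' i) i
          = rows (K + 1) C z' i := by
        intro i hi; simp [extz, hi]
      have hmem : (fun i : Fin (K + 1) => rows (K + 1) C z' i) ∈ P := by
        rw [Fintype.mem_piFinset]
        intro i
        rw [mem_Icc]
        constructor
        · unfold lo
          split_ifs with h
          · omega
          · have := rel_int_k hrel hr (fun i _ => hαC i) (fun c _ => (h2 c).2) (i - 1) (by omega)
            rwa [show (i : ℕ) - 1 + 1 = i by omega] at this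
        · exact rel_le_k hr hrel (fun i _ => rows_le _ _ _ i) (fun c _ => (h2 c).1) i i.2
      refine ⟨_, hmem, ?_⟩
      refine rel_unique_z (κ := rows (K + 1) C z') ?_ hr (cols_isCol _ _ _) h1
      intro c hc i hi
      rw [← p2 _ hmem c hc i hi, he i hi]
  · rw [sum_image]
    · unfold Dt
      rw [det_step x m K α b (fun i _ => rows_mono _ _ _ i)]
      refine sum_congr rfl fun κ hκ => ?_
      congr 1
      · rw [prod_pow_eq_pow_sum]
        congr 1
        rw [sum_sub_distrib, rel_sum hrel hz (fun i _ => hαC i),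
          rel_sum (p2 κ hκ) (cols_isCol _ _ _) (p3 κ hκ)]
        have e : ∀ i ∈ range (K + 1), extz κ i ≤ α i := fun i hi =>
          (p1 κ hκ i (mem_range.1 hi)).2
        have e2 := sum_le_sum e
        have e3 := sum_tsub_distrib (range (K + 1)) e
        rw [← Fin.sum_univ_eq_sum_range (fun i => α i - extz κ i)] at e3
        simp only [extz_fin] at e3
        rw [e3]
        omega
      · congr 1
        ext1 i j
        simp only [Matrix.of_apply]
        rw [p4 κ hκ i i.2, extz_fin]
    · intro κ hκ κ' hκ' h
      simp only at h
      ext i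
      rw [← extz_fin κ i, ← extz_fin κ' i, ← p4 κ hκ i i.2, h, p4 κ' hκ' i i.2]

/-- monomial weight -/
def wgt (x : ℕ → R) (C N : ℕ) (y : ℕ → ℕ → ℤ) : R :=
  ∏ l ∈ range N, x l ^ (∑ c ∈ range C, (y (l + 1) c - y l c)).toNat

theorem tab_sum (x : ℕ → R) (K C N : ℕ) (bot : ℕ → ℤ) (hb : IsCol (K + 1) C bot) (top : ℕ → ℤ)
    (ht : IsCol (K + 1) C top) : ∃ S : Finset (ℕ → ℕ → ℤ),
      (∀ y, y ∈ S ↔ Tab N bot top y) ∧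
      Dt x N (K + 1) C (fun j => rows (K + 1) C bot j + j) top = ∑ y ∈ S, wgt x C N y := by
  classical
  induction N generalizing top with
  | zero =>
    have hbase := det_base x (K + 1) (rows (K + 1) C top) (rows (K + 1) C bot)
      (fun i _ => rows_mono _ _ _ i) (fun i _ => rows_mono _ _ _ i)
    by_cases h : top = bot
    · refine ⟨{fun _ => bot}, ?_, ?_⟩
      · intro y
        rw [mem_singleton]
        constructor
        · rintro rfl
          exact ⟨fun _ c => hb.mono c, fun _ _ => le_rfl, fun _ _ => by omega, fun _ => rfl,
            fun _ _ _ => by rw [h]⟩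
        · intro hy
          funext m c
          rw [hy.top m (by omega) c, h]
      · unfold Dt
        rw [hbase, if_pos (by rw [h]; exact fun _ _ => rfl)]
        simp [wgt]
    · refine ⟨∅, ?_, ?_⟩
      · intro y
        simp only [notMem_empty, false_iff]
        intro hy
        apply h
        funext c
        rw [← hy.bot, ← hy.top 0 le_rfl]
      · unfold Dt
        rw [hbase, if_neg, sum_empty]
        intro he
        apply h
        refine rel_unique_z (rows_rel ht) (κ := rows (K + 1) C top) ?_ ht hb
        intro c hc i hi
        rw [← rows_rel hb c hc i hi, he i hi]
  | succ N ih =>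
    obtain ⟨S', hS', hdet⟩ := step_cols x N K C (fun j => rows (K + 1) C bot j + j) top ht
    choose! T hT using ih
    let ex : (Σ _ : ℕ → ℤ, ℕ → ℕ → ℤ) → ℕ → ℕ → ℤ := fun p m c => if m ≤ N then p.2 m c else top c
    refine ⟨(S'.sigma T).image ex, ?_, ?_⟩
    · intro y
      rw [mem_image]
      constructor
      · rintro ⟨⟨z', y'⟩, hmem, rfl⟩
        rw [mem_sigma] at hmem
        obtain ⟨h1, h2⟩ := hmem
        simp only at h1 h2
        obtain ⟨hc, hz'⟩ := (hS' z').1 h1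
        have hy := ((hT z' hc).1 y').1 h2
        have hN := hy.top N le_rfl
        refine ⟨?_, ?_, ?_, ?_, ?_⟩
        · intro m c
          simp only [ex]
          split_ifs
          · exact hy.mono m c
          · exact ht.mono c
        · intro m c
          simp only [ex]
          have := hy.up m c
          have := (hz' c).1
          split_ifs with h3 h4 h4
          · assumption
          · rw [show m = N by omega, hN]; assumption
          · omega
          · exact le_rfl
        · intro m c
          simp only [ex]
          have := hy.up1 m c
          have := (hz' c).2
          split_ifs with h3 h4 h4
          · assumption
          · omega
          · rw [show m = N by omega, hN]; assumption
          · omega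
        · intro c
          simp only [ex]
          rw [if_pos (by omega), hy.bot]
        · intro m hm c
          simp only [ex]
          rw [if_neg (by omega)]
      · intro hy
        have hge : ∀ m c, bot c ≤ y m c := by
          intro m c
          induction m with
          | zero => rw [hy.bot]
          | succ m ihm => exact ihm.trans (hy.up m c)
        have hNt : ∀ c, y N c ≤ top c := fun c => by
          rw [← hy.top (N + 1) le_rfl c]; exact hy.up N c
        have hcol : IsCol (K + 1) C (y N) := by
          refine ⟨hy.mono N, fun c => (hb.nonneg c).trans (hge N c), fun c hc => ?_⟩
          have h1 := hge N c
          have h2 := hNt c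
          rw [hb.out c hc] at h1
          rw [ht.out c hc] at h2
          omega
        have hmem : y N ∈ S' := by
          rw [hS']
          refine ⟨hcol, fun c => ⟨hNt c, ?_⟩⟩
          rw [← hy.top (N + 1) le_rfl c]; exact hy.up1 N c
        refine ⟨⟨y N, fun m c => y (min m N) c⟩, ?_, ?_⟩
        · rw [mem_sigma]
          refine ⟨hmem, ?_⟩
          simp only
          rw [(hT _ hcol).1]
          refine ⟨fun m c => hy.mono _ c, fun m c => ?_, fun m c => ?_, fun c => ?_, fun m hm c => ?_⟩
          · skip
            by_cases hm : m < N
            · rw [min_eq_left (by omega), min_eq_left (by omega)]; exact hy.up m c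
            · rw [min_eq_right (by omega), min_eq_right (by omega)]
          · skip
            by_cases hm : m < N
            · rw [min_eq_left (by omega), min_eq_left (by omega)]; exact hy.up1 m c
            · rw [min_eq_right (by omega), min_eq_right (by omega)]; omega
          · simp [hy.bot]
          · skip
            rw [min_eq_right hm]
        · funext m c
          simp only [ex]
          split_ifs with h
          · rw [min_eq_left h]
          · rw [hy.top m (by omega)]
    · rw [sum_image, sum_sigma, hdet]
      · refine sum_congr rfl fun z' hz' => ?_
        have hz'' := (hS' z').1 hz'
        rw [(hT z' hz''.1).2, mul_sum]
        refine sum_congr rfl fun y hy => ?_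
        have hyt := ((hT z' hz''.1).1 y).1 hy
        unfold wgt
        rw [prod_range_succ, mul_comm]
        congr 1
        · refine prod_congr rfl fun l hl => ?_
          rw [mem_range] at hl
          simp only [ex]
          simp only [if_pos (show l + 1 ≤ N by omega), if_pos (show l ≤ N by omega)]
        · simp only [ex]
          simp only [if_neg (show ¬ N + 1 ≤ N by omega), if_pos (le_refl N)]
          simp only [hyt.top N le_rfl]
      · rintro ⟨z1, y1⟩ h1 ⟨z2, y2⟩ h2 h
        simp only [coe_sigma, Set.mem_sigma_iff, mem_coe] at h1 h2
        have hy1 := ((hT z1 ((hS' z1).1 h1.1).1).1 y1).1 h1.2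
        have hy2 := ((hT z2 ((hS' z2).1 h2.1).1).1 y2).1 h2.2
        have hle : ∀ m ≤ N, y1 m = y2 m := by
          intro m hm
          have := congrFun h m
          simp only [ex, if_pos hm] at this
          funext c
          exact congrFun this c
        have hz : z1 = z2 := by
          funext c
          rw [← hy1.top N le_rfl, ← hy2.top N le_rfl, hle N le_rfl]
        subst hz
        have : y1 = y2 := by
          funext m c
          by_cases hm : m ≤ N
          · rw [hle m hm]
          · rw [hy1.top m (by omega), hy2.top m (by omega)]
        rw [this]

end

/-- column function of a partition with at most `k` parts -/
def colsL (k C : ℕ) (lam : ℕ → ℕ) : ℕ → ℤ := cols k C (fun i => lam (k - 1 - i))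

theorem colsL_isCol (k C : ℕ) (lam : ℕ → ℕ) : IsCol k C (colsL k C lam) := cols_isCol _ _ _

theorem colsL_rel {k C : ℕ} {lam : ℕ → ℕ} (h : Antitone lam) :
    Rel k C (fun i => lam (k - 1 - i)) (colsL k C lam) :=
  cols_rel fun i hi => h (by omega)

theorem colsL_max {k C : ℕ} {l1 l2 : ℕ → ℕ} (h1 : Antitone l1) (h2 : Antitone l2) :
    colsL k C (fun i => max (l1 i) (l2 i)) = fun c => max (colsL k C l1 c) (colsL k C l2 c) := by
  refine rel_unique_z (colsL_rel (fun a b hab => max_le_max (h1 hab) (h2 hab))) ?_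
    (colsL_isCol _ _ _) ?_
  · intro c hc i hi
    have e1 := colsL_rel (k := k) (C := C) h1 c hc i hi
    have e2 := colsL_rel (k := k) (C := C) h2 c hc i hi
    simp only at e1 e2 ⊢
    omega
  · have a1 := colsL_isCol k C l1
    have a2 := colsL_isCol k C l2
    refine ⟨fun c => max_le_max (a1.mono c) (a2.mono c), fun c => le_max_of_le_left (a1.nonneg c),
      fun c hc => by rw [a1.out c hc, a2.out c hc, max_self]⟩

theorem colsL_min {k C : ℕ} {l1 l2 : ℕ → ℕ} (h1 : Antitone l1) (h2 : Antitone l2) :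
    colsL k C (fun i => min (l1 i) (l2 i)) = fun c => min (colsL k C l1 c) (colsL k C l2 c) := by
  refine rel_unique_z (colsL_rel (fun a b hab => min_le_min (h1 hab) (h2 hab))) ?_
    (colsL_isCol _ _ _) ?_
  · intro c hc i hi
    have e1 := colsL_rel (k := k) (C := C) h1 c hc i hi
    have e2 := colsL_rel (k := k) (C := C) h2 c hc i hi
    simp only at e1 e2 ⊢
    omega
  · have a1 := colsL_isCol k C l1
    have a2 := colsL_isCol k C l2
    refine ⟨fun c => min_le_min (a1.mono c) (a2.mono c), fun c => le_min (a1.nonneg c) (a2.nonneg c),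
      fun c hc => by rw [a1.out c hc, a2.out c hc, min_self]⟩

theorem skewSchur_sum (N K C : ℕ) (lam mu : ℕ → ℕ) (hl : Antitone lam) (hm : Antitone mu)
    (hlC : ∀ i, lam i ≤ C) (hmC : ∀ i, mu i ≤ C) : ∃ S : Finset (ℕ → ℕ → ℤ),
      (∀ y, y ∈ S ↔ Tab N (colsL (K + 1) C mu) (colsL (K + 1) C lam) y) ∧
      skewSchur N (K + 1) lam mu = ∑ y ∈ S, wgt (xx N) C N y := by
  obtain ⟨S, hS, h⟩ := tab_sum (xx N) K C N (colsL (K + 1) C mu) (colsL_isCol _ _ _)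
    (colsL (K + 1) C lam) (colsL_isCol _ _ _)
  refine ⟨S, hS, ?_⟩
  rw [← h]
  unfold skewSchur Dt
  rw [← Matrix.det_submatrix_equiv_self Fin.revPerm]
  congr 1
  ext1 i j
  simp only [Matrix.submatrix_apply, Matrix.of_apply, Fin.revPerm_apply, Fin.val_rev]
  rw [homog_eq]
  have e1 := rel_unique (rows_rel (colsL_isCol (K + 1) C lam)) (colsL_rel hl)
    (fun i _ => rows_le _ _ _ i) (fun i _ => hlC _) i i.2
  have e2 := rel_unique (rows_rel (colsL_isCol (K + 1) C mu)) (colsL_rel hm)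
    (fun i _ => rows_le _ _ _ i) (fun i _ => hmC _) j j.2
  rw [e1, e2]
  simp only [show K + 1 - (i + 1 : ℕ) = K + 1 - 1 - (i : ℕ) by omega,
    show K + 1 - (j + 1 : ℕ) = K + 1 - 1 - (j : ℕ) by omega]
  congr 1
  have := i.2
  have := j.2
  push_cast
  omega

end Okounkov


namespace Okounkov

open Finset

theorem keyed_cancel {ι κ M : Type*} [LinearOrder ι] [WellFoundedLT ι] [Nonempty ι] [AddCommGroup M]
    (hM : ∀ a : M, a = -a → a = 0)
    (S : Finset κ) (f : κ → M) (viol : ι → κ → Prop) (op : ι → κ → κ)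
    [DecidablePred fun c => ∀ n, ¬ viol n c]
    (h : ∀ c ∈ S, ∀ n, viol n c → (∀ n' < n, ¬ viol n' c) →
      op n c ∈ S ∧ viol n (op n c) ∧ (∀ n' < n, ¬ viol n' (op n c)) ∧ op n (op n c) = c ∧
        f (op n c) = - f c) :
    ∑ c ∈ S, f c = ∑ c ∈ S with ∀ n, ¬ viol n c, f c := by
  classical
  rw [← sum_filter_add_sum_filter_not S (fun c => ∀ n, ¬ viol n c)]
  rw [add_eq_left]
  have hfirst : ∀ c, (¬ ∀ n, ¬ viol n c) → ∃ n, viol n c ∧ ∀ n' < n, ¬ viol n' c := by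
    intro c hc
    push Not at hc
    obtain ⟨n, hn, hmin⟩ := WellFounded.has_min (wellFounded_lt (α := ι)) {n | viol n c} hc
    exact ⟨n, hn, fun n' hn' hv => hmin n' hv hn'⟩
  choose! fst hfst using hfirst
  have huniq : ∀ c n m, viol n c → (∀ n' < n, ¬ viol n' c) → viol m c → (∀ n' < m, ¬ viol n' c) →
      n = m := by
    intro c n m h1 h2 h3 h4
    rcases lt_trichotomy n m with hl | hl | hl
    · exact absurd h1 (h4 n hl)
    · exact hl
    · exact absurd h3 (h2 m hl)
  have hmain : ∀ c ∈ S.filter (fun c => ¬ ∀ n, ¬ viol n c),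
      op (fst c) c ∈ S.filter (fun c => ¬ ∀ n, ¬ viol n c) ∧ fst (op (fst c) c) = fst c ∧
      op (fst c) (op (fst c) c) = c ∧ f (op (fst c) c) = - f c := by
    intro c hc
    rw [mem_filter] at hc
    obtain ⟨h1, h2⟩ := hfst c hc.2
    obtain ⟨a1, a2, a3, a4, a5⟩ := h c hc.1 (fst c) h1 h2
    have hv : ¬ ∀ n, ¬ viol n (op (fst c) c) := fun hh => hh _ a2
    obtain ⟨b1, b2⟩ := hfst _ hv
    exact ⟨mem_filter.2 ⟨a1, hv⟩, huniq _ _ _ b1 b2 a2 a3, a4, a5⟩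
  refine sum_involution (fun c _ => op (fst c) c) ?_ ?_ ?_ ?_
  · intro c hc
    rw [(hmain c hc).2.2.2]; simp
  · intro c hc hne heq
    apply hne
    apply hM
    have := (hmain c hc).2.2.2
    rw [heq] at this
    exact this
  · intro c hc
    exact (hmain c hc).1
  · intro c hc
    rw [(hmain c hc).2.1, (hmain c hc).2.2.1]

theorem exists_rho (p C : ℕ) (A B : ℕ → ℤ) (hA : Monotone A) (hB : Monotone B) : ∃ ρ : ℕ → ℕ,
    (∀ c, p ≤ c → c < C → p ≤ ρ c ∧ ρ c < C ∧ ρ (ρ c) = c ∧ A (ρ c) = A c ∧ B (ρ c) = B c) ∧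
    (∀ c, p ≤ c → c + 1 < C → A c = A (c + 1) → B c = B (c + 1) → ρ c = ρ (c + 1) + 1) := by
  classical
  let b : ℕ → Finset ℕ := fun c => (Ico p C).filter (fun c' => A c' = A c ∧ B c' = B c)
  have hself : ∀ c, p ≤ c → c < C → c ∈ b c := fun c h1 h2 => by simp [b, h1, h2]
  have hb : ∀ c c', c' ∈ b c → b c' = b c := by
    intro c c' h
    simp only [b, mem_filter] at h
    simp only [b, h.2.1, h.2.2]
  let ρ : ℕ → ℕ := fun c => if h : (b c).Nonempty then (b c).min' h + (b c).max' h - c else c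
  have key : ∀ c, p ≤ c → c < C → ∃ f g, f ∈ b c ∧ g ∈ b c ∧ f ≤ c ∧ c ≤ g ∧
      (∀ c' ∈ b c, ρ c' = f + g - c') ∧ (∀ c' ∈ b c, f ≤ c' ∧ c' ≤ g) := by
    intro c h1 h2
    have hne : (b c).Nonempty := ⟨c, hself c h1 h2⟩
    refine ⟨(b c).min' hne, (b c).max' hne, min'_mem _ _, max'_mem _ _, min'_le _ _ (hself c h1 h2),
      le_max' _ _ (hself c h1 h2), ?_, fun c' hc' => ⟨min'_le _ _ hc', le_max' _ _ hc'⟩⟩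
    intro c' hc'
    have e := hb c c' hc'
    simp only [ρ, e]
    rw [dif_pos hne]
  refine ⟨ρ, ?_, ?_⟩
  · intro c h1 h2
    obtain ⟨f, g, hf, hg, hfc, hcg, hρ, hfg⟩ := key c h1 h2
    have e := hρ c (hself c h1 h2)
    have hmem : ρ c ∈ b c := by
      rw [e]
      simp only [b, mem_filter, mem_Ico] at hf hg ⊢
      have a1 := hA (show f ≤ f + g - c by omega)
      have a2 := hA (show f + g - c ≤ g by omega)
      have a3 := hB (show f ≤ f + g - c by omega)
      have a4 := hB (show f + g - c ≤ g by omega)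
      refine ⟨by omega, by omega, by omega⟩
    have e2 := hρ _ hmem
    simp only [b, mem_filter, mem_Ico] at hmem
    exact ⟨hmem.1.1, hmem.1.2, by omega, hmem.2.1, hmem.2.2⟩
  · intro c h1 h2 hAe hBe
    obtain ⟨f, g, hf, hg, hfc, hcg, hρ, hfg⟩ := key c h1 (by omega)
    have e := hρ c (hself c h1 (by omega))
    have hm : c + 1 ∈ b c := by
      simp only [b, mem_filter, mem_Ico]
      exact ⟨by omega, hAe.symm, hBe.symm⟩
    have e2 := hρ _ hm
    have := (hfg _ hm).2
    omega

/-- block reversal -/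
noncomputable def rho (p C : ℕ) (A B : ℕ → ℤ) : ℕ → ℕ := by
  classical
  exact if h : Monotone A ∧ Monotone B then Classical.choose (exists_rho p C A B h.1 h.2) else id

theorem rho_spec (p C : ℕ) (A B : ℕ → ℤ) (hA : Monotone A) (hB : Monotone B) :
    (∀ c, p ≤ c → c < C → p ≤ rho p C A B c ∧ rho p C A B c < C ∧ rho p C A B (rho p C A B c) = c ∧
      A (rho p C A B c) = A c ∧ B (rho p C A B c) = B c) ∧
    (∀ c, p ≤ c → c + 1 < C → A c = A (c + 1) → B c = B (c + 1) →
      rho p C A B c = rho p C A B (c + 1) + 1) := by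
  unfold rho
  rw [dif_pos ⟨hA, hB⟩]
  exact Classical.choose_spec (exists_rho p C A B hA hB)

/-- tail operation -/
noncomputable def tail (C l p : ℕ) (y : ℕ → ℕ → ℤ) : ℕ → ℕ → ℤ := fun m c =>
  if m = l + 1 ∧ p ≤ c ∧ c < C then y l c + y (l + 2) c - y (l + 1) (rho p C (y l) (y (l + 2)) c)
  else y m c

theorem tail_row {C l p : ℕ} {y : ℕ → ℕ → ℤ} {m : ℕ} (h : m ≠ l + 1) : tail C l p y m = y m := by
  funext c
  unfold tail
  rw [if_neg (fun hh => h hh.1)]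

theorem tail_left {C l p : ℕ} {y : ℕ → ℕ → ℤ} {m c : ℕ} (h : c < p) : tail C l p y m c = y m c := by
  unfold tail
  rw [if_neg (by omega)]

theorem tail_right {C l p : ℕ} {y : ℕ → ℕ → ℤ} {m c : ℕ} (h : C ≤ c) : tail C l p y m c = y m c := by
  unfold tail
  rw [if_neg (by omega)]

theorem tail_mid {C l p : ℕ} {y : ℕ → ℕ → ℤ} {c : ℕ} (h : p ≤ c) (h2 : c < C) :
    tail C l p y (l + 1) c = y l c + y (l + 2) c - y (l + 1) (rho p C (y l) (y (l + 2)) c) := by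
  unfold tail
  rw [if_pos ⟨rfl, h, h2⟩]

theorem Tab.monotone {N : ℕ} {bot top : ℕ → ℤ} {y : ℕ → ℕ → ℤ} (h : Tab N bot top y) (m : ℕ) :
    Monotone (y m) := monotone_nat_of_le_succ (h.mono m)

theorem tail_tail {N : ℕ} {bot top : ℕ → ℤ} {y : ℕ → ℕ → ℤ} (h : Tab N bot top y) (C l p : ℕ) :
    tail C l p (tail C l p y) = y := by
  funext m c
  by_cases hm : m = l + 1 ∧ p ≤ c ∧ c < C
  · obtain ⟨rfl, h1, h2⟩ := hm
    obtain ⟨a1, a2, a3, a4, a5⟩ := (rho_spec p C _ _ (h.monotone l) (h.monotone (l + 2))).1 c h1 h2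
    rw [tail_mid h1 h2, tail_row (by omega), tail_row (by omega), tail_mid a1 a2, a3, a4, a5]
    ring
  · rw [tail, if_neg hm, tail, if_neg hm]

theorem Tab.bounds {N : ℕ} {bot top : ℕ → ℤ} {y : ℕ → ℕ → ℤ} (h : Tab N bot top y) (l c : ℕ) :
    y l c ≤ y (l + 1) c ∧ y (l + 1) c ≤ y l c + 1 ∧ y (l + 1) c ≤ y (l + 2) c ∧
      y (l + 2) c ≤ y (l + 1) c + 1 :=
  ⟨h.up l c, h.up1 l c, h.up (l + 1) c, h.up1 (l + 1) c⟩

theorem tail_bounds {N : ℕ} {bot top : ℕ → ℤ} {y : ℕ → ℕ → ℤ} (h : Tab N bot top y) (C l p c : ℕ) :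
    y l c ≤ tail C l p y (l + 1) c ∧ tail C l p y (l + 1) c ≤ y l c + 1 ∧
    tail C l p y (l + 1) c ≤ y (l + 2) c ∧ y (l + 2) c ≤ tail C l p y (l + 1) c + 1 := by
  by_cases hm : p ≤ c ∧ c < C
  · obtain ⟨a1, a2, a3, a4, a5⟩ :=
      (rho_spec p C _ _ (h.monotone l) (h.monotone (l + 2))).1 c hm.1 hm.2
    rw [tail_mid hm.1 hm.2]
    have := h.bounds l (rho p C (y l) (y (l + 2)) c)
    rw [a4, a5] at this
    omega
  · rw [tail, if_neg (fun hh => hm hh.2)]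
    exact h.bounds l c

theorem tail_tab {N : ℕ} {bot top : ℕ → ℤ} {y : ℕ → ℕ → ℤ} (h : Tab N bot top y) (C l p : ℕ)
    (kk : ℤ) (hout : ∀ m c, C ≤ c → y m c = kk) (hl : l + 1 < N)
    (hclean : ∀ c, c + 1 = p → y (l + 1) c ≤ y l p ∨ y (l + 1) c ≤ y (l + 2) p - 1) :
    Tab N bot top (tail C l p y) := by
  have hbd := tail_bounds h C l p
  refine ⟨?_, ?_, ?_, ?_, ?_⟩
  · intro m c
    by_cases hm : m = l + 1
    · subst hm
      have b1 := hbd c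
      have b2 := hbd (c + 1)
      have mA := h.mono l c
      have mB := h.mono (l + 2) c
      by_cases h1 : c + 1 < p
      · rw [tail_left h1, tail_left (by omega)]; exact h.mono _ _
      · by_cases h2 : c + 1 = p
        · rw [tail_left (show c < p by omega)]
          have := hclean c h2
          rw [← h2] at this
          rw [← h2] at b2 ⊢
          omega
        · by_cases h3 : C ≤ c + 1
          · rw [tail_right h3, hout _ _ h3]
            have := hout (l + 2) (c + 1) h3
            omega
          · by_cases hs : y l c = y l (c + 1) ∧ y (l + 2) c = y (l + 2) (c + 1)
            · have := (rho_spec p C _ _ (h.monotone l) (h.monotone (l + 2))).2 c (by omega)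
                (by omega) hs.1 hs.2
              rw [tail_mid (by omega) (by omega), tail_mid (by omega) (by omega), this]
              have := h.mono (l + 1) (rho p C (y l) (y (l + 2)) (c + 1))
              omega
            · omega
    · rw [tail_row hm]; exact h.mono m c
  · intro m c
    have b1 := hbd c
    by_cases hm : m = l + 1
    · subst hm
      rw [tail_row (m := l + 1 + 1) (by omega)]
      exact b1.2.2.1
    · rw [tail_row hm]
      by_cases hm2 : m = l
      · subst hm2; exact b1.1
      · rw [tail_row (by omega)]; exact h.up m c
  · intro m c
    have b1 := hbd c
    by_cases hm : m = l + 1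
    · subst hm
      rw [tail_row (m := l + 1 + 1) (by omega)]
      exact b1.2.2.2
    · rw [tail_row hm]
      by_cases hm2 : m = l
      · subst hm2; exact b1.2.1
      · rw [tail_row (by omega)]; exact h.up1 m c
  · intro c
    rw [tail_row (by omega), h.bot]
  · intro m hm c
    rw [tail_row (by omega), h.top m hm]

/-- second difference -/
def dl (y : ℕ → ℕ → ℤ) (l c : ℕ) : ℤ := y (l + 2) c - 2 * y (l + 1) c + y l c

theorem tail_sum {N : ℕ} {bot top : ℕ → ℤ} {y : ℕ → ℕ → ℤ} (h : Tab N bot top y) (C l p : ℕ)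
    (hp : p ≤ C) :
    ∑ c ∈ range C, tail C l p y (l + 1) c = ∑ c ∈ range C, (y l c + y (l + 2) c - y (l + 1) c)
      - ∑ c ∈ range p, dl y l c := by
  rw [range_eq_Ico, range_eq_Ico, ← sum_Ico_consecutive _ (Nat.zero_le p) hp,
    ← sum_Ico_consecutive (fun c => y l c + y (l + 2) c - y (l + 1) c) (Nat.zero_le p) hp]
  have hr := (rho_spec p C _ _ (h.monotone l) (h.monotone (l + 2))).1
  have e1 : ∑ c ∈ Ico p C, tail C l p y (l + 1) c
      = ∑ c ∈ Ico p C, (y l c + y (l + 2) c - y (l + 1) c) := by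
    refine sum_nbij' (rho p C (y l) (y (l + 2))) (rho p C (y l) (y (l + 2))) ?_ ?_ ?_ ?_ ?_
    · intro c hc; rw [mem_Ico] at *; have := hr c hc.1 hc.2; omega
    · intro c hc; rw [mem_Ico] at *; have := hr c hc.1 hc.2; omega
    · intro c hc; rw [mem_Ico] at *; have := hr c hc.1 hc.2; omega
    · intro c hc; rw [mem_Ico] at *; have := hr c hc.1 hc.2; omega
    · intro c hc
      rw [mem_Ico] at hc
      obtain ⟨a1, a2, a3, a4, a5⟩ := hr c hc.1 hc.2
      rw [tail_mid hc.1 hc.2, a4, a5]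
  have e2 : ∑ c ∈ Ico 0 p, tail C l p y (l + 1) c
      = ∑ c ∈ Ico 0 p, (y l c + y (l + 2) c - y (l + 1) c) - ∑ c ∈ Ico 0 p, dl y l c := by
    rw [← sum_sub_distrib]
    refine sum_congr rfl fun c hc => ?_
    rw [mem_Ico] at hc
    rw [tail_left hc.2, dl]; ring
  rw [e1, e2]; ring

end Okounkov


namespace Okounkov

open Finset

/-- pairs of tableaux -/
abbrev PT := (ℕ → ℕ → ℤ) × (ℕ → ℕ → ℤ)

/-- partial sums of second differences -/
def DD (c : PT) (l p : ℕ) : ℤ := ∑ q ∈ range p, (dl c.1 l q + dl c.2 l q)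

/-- violation of the first kind -/
def V1 (c : PT) (p l : ℕ) : Prop := 1 ≤ DD c l (p + 1)

/-- violation of the second kind -/
def A2 (c : PT) (p l : ℕ) : Prop :=
  DD c l p = 0 ∧ c.1 (l + 2) p = c.1 l p + 1 ∧ c.2 (l + 2) p = c.2 l p + 1 ∧
    ((c.1 l p ≤ c.2 l p ∧ c.1 (l + 1) p = c.1 l p) ∨ (c.2 l p < c.1 l p ∧ c.2 (l + 1) p = c.2 l p))

theorem DD_succ (c : PT) (l p : ℕ) : DD c l (p + 1) = DD c l p + (dl c.1 l p + dl c.2 l p) := by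
  unfold DD; rw [sum_range_succ]

theorem DD_congr {c c' : PT} {l p : ℕ} (h1 : ∀ m, ∀ q < p, c'.1 m q = c.1 m q)
    (h2 : ∀ m, ∀ q < p, c'.2 m q = c.2 m q) : DD c' l p = DD c l p := by
  unfold DD
  refine sum_congr rfl fun q hq => ?_
  rw [mem_range] at hq
  simp only [dl, h1 _ q hq, h2 _ q hq]

theorem V1_congr {c c' : PT} {l p : ℕ} (h1 : ∀ m, ∀ q ≤ p, c'.1 m q = c.1 m q)
    (h2 : ∀ m, ∀ q ≤ p, c'.2 m q = c.2 m q) : V1 c' p l ↔ V1 c p l := by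
  unfold V1
  rw [DD_congr (fun m q hq => h1 m q (by omega)) (fun m q hq => h2 m q (by omega))]

theorem A2_congr {c c' : PT} {l p : ℕ} (h1 : ∀ m, ∀ q ≤ p, c'.1 m q = c.1 m q)
    (h2 : ∀ m, ∀ q ≤ p, c'.2 m q = c.2 m q) : A2 c' p l ↔ A2 c p l := by
  unfold A2
  rw [DD_congr (fun m q hq => h1 m q (by omega)) (fun m q hq => h2 m q (by omega))]
  simp only [h1 _ p le_rfl, h2 _ p le_rfl]

/-- pair of weights -/
def wt2 (C : ℕ) (c : PT) (l : ℕ) : ℤ :=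
  ∑ q ∈ range C, ((c.1 (l + 1) q - c.1 l q) + (c.2 (l + 1) q - c.2 l q))

/-- second kind operation -/
noncomputable def opA (C p l : ℕ) (c : PT) : PT :=
  if c.1 l p ≤ c.2 l p then (tail C l (p + 1) c.1, tail C l p c.2)
  else (tail C l p c.1, tail C l (p + 1) c.2)

/-- first kind operation -/
noncomputable def opV (C p l : ℕ) (c : PT) : PT := (tail C l (p + 1) c.1, tail C l (p + 1) c.2)

section
variable {N : ℕ} {b1 t1 b2 t2 : ℕ → ℤ} {C : ℕ} {kk : ℤ} {c : PT}

theorem wt_tails (h1 : Tab N b1 t1 c.1) (h2 : Tab N b2 t2 c.2) (l p q : ℕ) (hp : p ≤ C) (hq : q ≤ C)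
    (hD : ∑ i ∈ range p, dl c.1 l i + ∑ i ∈ range q, dl c.2 l i = 1) :
    wt2 C (tail C l p c.1, tail C l q c.2) l = wt2 C c (l + 1) - 1 ∧
    wt2 C (tail C l p c.1, tail C l q c.2) (l + 1) = wt2 C c l + 1 ∧
    ∀ i, i ≠ l → i ≠ l + 1 → wt2 C (tail C l p c.1, tail C l q c.2) i = wt2 C c i := by
  have e1 := tail_sum h1 C l p hp
  have e2 := tail_sum h2 C l q hq
  simp only [sum_add_distrib, sum_sub_distrib] at e1 e2
  refine ⟨?_, ?_, ?_⟩
  · simp only [wt2, sum_add_distrib, sum_sub_distrib, tail_row (show l ≠ l + 1 by omega)]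
    rw [show l + 1 + 1 = l + 2 by omega]
    linarith
  · simp only [wt2, sum_add_distrib, sum_sub_distrib, tail_row (show l + 1 + 1 ≠ l + 1 by omega)]
    rw [show l + 1 + 1 = l + 2 by omega]
    linarith
  · intro i hi hi2
    simp only [wt2, tail_row hi2, tail_row (show i + 1 ≠ l + 1 by omega)]

theorem dl_le (h1 : Tab N b1 t1 c.1) (l p : ℕ) : dl c.1 l p ≤ 1 := by
  have := h1.bounds l p
  unfold dl; omega

theorem A2_incompat (h1 : Tab N b1 t1 c.1) (h2 : Tab N b2 t2 c.2) (p l : ℕ)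
    (ha : A2 c p (l + 1)) (hb : A2 c p l) : False := by
  unfold A2 at ha hb
  have := h1.bounds l p
  have := h2.bounds l p
  have := h1.bounds (l + 1) p
  have := h2.bounds (l + 1) p
  simp only [show l + 1 + 1 = l + 2 by omega, show l + 1 + 2 = l + 3 by omega] at *
  omega

theorem DD_nonpos (p l : ℕ) (hV : ∀ p' < p, ¬ V1 c p' l) : DD c l p ≤ 0 := by
  cases p with
  | zero => simp [DD]
  | succ p => have := hV p (by omega); unfold V1 at this; omega

theorem opV_ok (h1 : Tab N b1 t1 c.1) (h2 : Tab N b2 t2 c.2)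
    (o1 : ∀ m q, C ≤ q → c.1 m q = kk) (o2 : ∀ m q, C ≤ q → c.2 m q = kk)
    (p l : ℕ) (hl : l + 1 < N) (hp : p < C)
    (hv : V1 c p l) (hV : ∀ p' < p, ¬ V1 c p' l) (hA : ¬ A2 c p l) :
    Tab N b1 t1 (opV C p l c).1 ∧ Tab N b2 t2 (opV C p l c).2 ∧ DD c l (p + 1) = 1 := by
  have hD := DD_nonpos p l hV
  have hs := DD_succ c l p
  unfold V1 at hv
  unfold A2 at hA
  have g1 := h1.bounds l p
  have g2 := h2.bounds l p
  have m1 := h1.mono l p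
  have m2 := h2.mono l p
  have m3 := h1.mono (l + 2) p
  have m4 := h2.mono (l + 2) p
  unfold dl at hs
  refine ⟨tail_tab h1 C l (p + 1) kk o1 hl ?_, tail_tab h2 C l (p + 1) kk o2 hl ?_, by omega⟩
  · intro q hq
    obtain rfl : q = p := by omega
    omega
  · intro q hq
    obtain rfl : q = p := by omega
    omega

theorem opA_ok (h1 : Tab N b1 t1 c.1) (h2 : Tab N b2 t2 c.2)
    (o1 : ∀ m q, C ≤ q → c.1 m q = kk) (o2 : ∀ m q, C ≤ q → c.2 m q = kk)
    (p l : ℕ) (hl : l + 1 < N)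
    (ha : A2 c p l) (hV : ∀ p' < p, ¬ V1 c p' l) (hA : ∀ p' < p, ¬ A2 c p' l) :
    Tab N b1 t1 (opA C p l c).1 ∧ Tab N b2 t2 (opA C p l c).2 := by
  unfold A2 at ha
  unfold opA
  have m1 := h1.mono l p
  have m2 := h2.mono l p
  split_ifs with hle
  · refine ⟨tail_tab h1 C l (p + 1) kk o1 hl ?_, tail_tab h2 C l p kk o2 hl ?_⟩
    · intro q hq
      obtain rfl : q = p := by omega
      omega
    · rintro q rfl
      have hD := DD_nonpos q l (fun p' hp' => hV p' (by omega))
      have hs := DD_succ c l q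
      have hq := hA q (by omega)
      unfold A2 at hq
      have g1 := h1.bounds l q
      have g2 := h2.bounds l q
      have m3 := h1.mono l q
      have m4 := h2.mono l q
      have m5 := h2.mono (l + 2) q
      unfold dl at hs
      omega
  · refine ⟨tail_tab h1 C l p kk o1 hl ?_, tail_tab h2 C l (p + 1) kk o2 hl ?_⟩
    · rintro q rfl
      have hD := DD_nonpos q l (fun p' hp' => hV p' (by omega))
      have hs := DD_succ c l q
      have hq := hA q (by omega)
      unfold A2 at hq
      have g1 := h1.bounds l q
      have g2 := h2.bounds l q
      have m3 := h1.mono l q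
      have m4 := h2.mono l q
      have m5 := h1.mono (l + 2) q
      unfold dl at hs
      omega
    · intro q hq
      obtain rfl : q = p := by omega
      omega

theorem opA_row {p l m : ℕ} (h : m ≠ l + 1) : (opA C p l c).1 m = c.1 m ∧ (opA C p l c).2 m = c.2 m := by
  unfold opA
  split_ifs <;> exact ⟨tail_row h, tail_row h⟩

theorem opA_left {p l m q : ℕ} (h : q < p) :
    (opA C p l c).1 m q = c.1 m q ∧ (opA C p l c).2 m q = c.2 m q := by
  unfold opA
  split_ifs <;> exact ⟨tail_left (by omega), tail_left (by omega)⟩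

theorem opA_A2 {p l : ℕ} (ha : A2 c p l) : A2 (opA C p l c) p l := by
  unfold A2 at *
  rw [DD_congr (fun m q hq => (opA_left hq).1) (fun m q hq => (opA_left hq).2),
    (opA_row (show l ≠ l + 1 by omega)).1, (opA_row (show l ≠ l + 1 by omega)).2,
    (opA_row (show l + 2 ≠ l + 1 by omega)).1, (opA_row (show l + 2 ≠ l + 1 by omega)).2]
  refine ⟨ha.1, ha.2.1, ha.2.2.1, ?_⟩
  rcases ha.2.2.2 with h | h
  · left
    unfold opA
    rw [if_pos h.1]
    exact ⟨h.1, (tail_left (by omega)).trans h.2⟩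
  · right
    unfold opA
    rw [if_neg (by omega)]
    exact ⟨h.1, (tail_left (by omega)).trans h.2⟩

theorem opA_opA (h1 : Tab N b1 t1 c.1) (h2 : Tab N b2 t2 c.2) (p l : ℕ) :
    opA C p l (opA C p l c) = c := by
  have e1 := (opA_row (C := C) (c := c) (p := p) (show l ≠ l + 1 by omega)).1
  have e2 := (opA_row (C := C) (c := c) (p := p) (show l ≠ l + 1 by omega)).2
  rw [opA, e1, e2]
  unfold opA
  split_ifs
  · simp only [tail_tail h1, tail_tail h2]
  · simp only [tail_tail h1, tail_tail h2]

theorem opV_opV (h1 : Tab N b1 t1 c.1) (h2 : Tab N b2 t2 c.2) (p l : ℕ) :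
    opV C p l (opV C p l c) = c := by
  unfold opV
  simp only [tail_tail h1, tail_tail h2]

theorem opA_wt (h1 : Tab N b1 t1 c.1) (h2 : Tab N b2 t2 c.2) (p l : ℕ) (hp : p < C)
    (ha : A2 c p l) :
    wt2 C (opA C p l c) l = wt2 C c (l + 1) - 1 ∧
    wt2 C (opA C p l c) (l + 1) = wt2 C c l + 1 ∧
    ∀ i, i ≠ l → i ≠ l + 1 → wt2 C (opA C p l c) i = wt2 C c i := by
  unfold A2 at ha
  unfold DD at ha
  rw [sum_add_distrib] at ha
  unfold opA
  split_ifs with hle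
  · apply wt_tails h1 h2 l (p + 1) p (by omega) (by omega)
    rw [sum_range_succ]
    have : dl c.1 l p = 1 := by unfold dl; omega
    omega
  · apply wt_tails h1 h2 l p (p + 1) (by omega) (by omega)
    rw [sum_range_succ]
    have : dl c.2 l p = 1 := by unfold dl; omega
    omega

theorem opV_wt (h1 : Tab N b1 t1 c.1) (h2 : Tab N b2 t2 c.2) (p l : ℕ) (hp : p < C)
    (hD : DD c l (p + 1) = 1) :
    wt2 C (opV C p l c) l = wt2 C c (l + 1) - 1 ∧
    wt2 C (opV C p l c) (l + 1) = wt2 C c l + 1 ∧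
    ∀ i, i ≠ l → i ≠ l + 1 → wt2 C (opV C p l c) i = wt2 C c i := by
  unfold DD at hD
  rw [sum_add_distrib] at hD
  exact wt_tails h1 h2 l (p + 1) (p + 1) (by omega) (by omega) hD

end

/-- keys -/
abbrev Key := ℕ ×ₗ (ℕ ×ₗ ℕ)

/-- violation of a key -/
def viol (N C : ℕ) (n : Key) (c : PT) : Prop :=
  (ofLex n).1 < C ∧ (ofLex (ofLex n).2).2 + 1 < N ∧
    (((ofLex (ofLex n).2).1 = 0 ∧ A2 c (ofLex n).1 (ofLex (ofLex n).2).2) ∨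
     ((ofLex (ofLex n).2).1 = 1 ∧ V1 c (ofLex n).1 (ofLex (ofLex n).2).2))

/-- operation of a key -/
noncomputable def kop (C : ℕ) (n : Key) (c : PT) : PT :=
  if (ofLex (ofLex n).2).1 = 0 then opA C (ofLex n).1 (ofLex (ofLex n).2).2 c
  else opV C (ofLex n).1 (ofLex (ofLex n).2).2 c

theorem key_lt (p s l p' s' l' : ℕ) :
    (toLex (p, toLex (s, l)) : Key) < toLex (p', toLex (s', l')) ↔
      p < p' ∨ (p = p' ∧ (s < s' ∨ (s = s' ∧ l < l'))) := by
  rw [Prod.Lex.toLex_lt_toLex, Prod.Lex.toLex_lt_toLex]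

/-- no violations -/
def NV (N C : ℕ) (c : PT) : Prop := ∀ p < C, ∀ l, l + 1 < N → ¬ A2 c p l ∧ ¬ V1 c p l

theorem NV_iff (N C : ℕ) (c : PT) : NV N C c ↔ ∀ n, ¬ viol N C n c := by
  constructor
  · rintro h n ⟨h1, h2, h3⟩
    have := h _ h1 _ h2
    rcases h3 with h3 | h3
    · exact this.1 h3.2
    · exact this.2 h3.2
  · intro h p hp l hl
    exact ⟨fun ha => h (toLex (p, toLex (0, l))) ⟨hp, hl, Or.inl ⟨rfl, ha⟩⟩,
      fun ha => h (toLex (p, toLex (1, l))) ⟨hp, hl, Or.inr ⟨rfl, ha⟩⟩⟩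

theorem cancel (N C : ℕ) (kk : ℤ) (b1 t1 b2 t2 : ℕ → ℤ) (S : Finset PT)
    (hS : ∀ c, c ∈ S ↔ Tab N b1 t1 c.1 ∧ Tab N b2 t2 c.2)
    (hout : ∀ c ∈ S, (∀ m q, C ≤ q → c.1 m q = kk) ∧ (∀ m q, C ≤ q → c.2 m q = kk))
    [DecidablePred (NV N C)] :
    ∑ c ∈ S, sdet N (fun i => wt2 C c i) = ∑ c ∈ S with NV N C c, sdet N (fun i => wt2 C c i) := by
  classical
  have hM : ∀ a : MvPolynomial (Fin N) ℤ, a = -a → a = 0 := by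
    intro a ha
    exact self_eq_neg.mp ha
  have := keyed_cancel hM S (fun c => sdet N (fun i => wt2 C c i)) (viol N C) (kop C) ?_
  · rw [this]
    refine sum_congr ?_ fun _ _ => rfl
    ext c
    rw [mem_filter, mem_filter, NV_iff]
  · intro c hc n hv hmin
    obtain ⟨h1, h2⟩ := (hS c).1 hc
    obtain ⟨o1, o2⟩ := hout c hc
    obtain ⟨p, s, l, rfl⟩ : ∃ p s l, n = toLex (p, toLex (s, l)) :=
      ⟨(ofLex n).1, (ofLex (ofLex n).2).1, (ofLex (ofLex n).2).2, rfl⟩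
    have hminA : ∀ p' l', l' + 1 < N → p' < C →
        (p' < p ∨ (p' = p ∧ (0 < s ∨ (0 = s ∧ l' < l)))) → ¬ A2 c p' l' := by
      intro p' l' h1 h2 h3 ha
      exact hmin (toLex (p', toLex (0, l'))) ((key_lt _ _ _ _ _ _).2 h3) ⟨h2, h1, Or.inl ⟨rfl, ha⟩⟩
    have hminV : ∀ p' l', l' + 1 < N → p' < C →
        (p' < p ∨ (p' = p ∧ (1 < s ∨ (1 = s ∧ l' < l)))) → ¬ V1 c p' l' := by
      intro p' l' h1 h2 h3 ha
      exact hmin (toLex (p', toLex (1, l'))) ((key_lt _ _ _ _ _ _).2 h3) ⟨h2, h1, Or.inr ⟨rfl, ha⟩⟩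
    obtain ⟨hp, hl, hv⟩ := hv
    simp only [ofLex_toLex] at hp hl hv
    rcases hv with ⟨rfl, ha⟩ | ⟨rfl, hv⟩
    · have hk : ∀ c, kop C (toLex (p, toLex (0, l))) c = opA C p l c := fun c => by
        simp [kop]
      obtain ⟨g1, g2⟩ := opA_ok h1 h2 o1 o2 p l hl ha
        (fun p' hp' => hminV p' l hl (by omega) (Or.inl hp'))
        (fun p' hp' => hminA p' l hl (by omega) (Or.inl hp'))
      rw [hk]
      have ha' := opA_A2 (C := C) ha
      refine ⟨(hS _).2 ⟨g1, g2⟩, ⟨hp, hl, Or.inl ⟨rfl, ha'⟩⟩, ?_, ?_, ?_⟩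
      · rintro n' hn' ⟨q1, q2, q3⟩
        obtain ⟨p', s', l', rfl⟩ : ∃ p s l, n' = toLex (p, toLex (s, l)) :=
          ⟨(ofLex n').1, (ofLex (ofLex n').2).1, (ofLex (ofLex n').2).2, rfl⟩
        rw [key_lt] at hn'
        simp only [ofLex_toLex] at q1 q2 q3
        rcases hn' with hn' | ⟨rfl, hn' | ⟨rfl, hn'⟩⟩
        · rcases q3 with ⟨_, q3⟩ | ⟨_, q3⟩
          · rw [A2_congr (c := c) (fun m q hq => (opA_left (by omega)).1)
              (fun m q hq => (opA_left (by omega)).2)] at q3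
            exact hminA p' l' q2 q1 (Or.inl hn') q3
          · rw [V1_congr (c := c) (fun m q hq => (opA_left (by omega)).1)
              (fun m q hq => (opA_left (by omega)).2)] at q3
            exact hminV p' l' q2 q1 (Or.inl hn') q3
        · omega
        · rcases q3 with ⟨_, q3⟩ | ⟨h0, _⟩
          · by_cases hll : l = l' + 1
            · subst hll
              exact A2_incompat g1 g2 p' l' ha' q3
            · apply hminA p' l' q2 q1 (Or.inr ⟨rfl, Or.inr ⟨rfl, hn'⟩⟩)
              unfold A2 at q3 ⊢
              rw [DD_congr (c := c) (fun m q hq => (opA_left (by omega)).1)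
                (fun m q hq => (opA_left (by omega)).2),
                (opA_row (show l' ≠ l + 1 by omega)).1, (opA_row (show l' ≠ l + 1 by omega)).2,
                (opA_row (show l' + 1 ≠ l + 1 by omega)).1, (opA_row (show l' + 1 ≠ l + 1 by omega)).2,
                (opA_row (show l' + 2 ≠ l + 1 by omega)).1,
                (opA_row (show l' + 2 ≠ l + 1 by omega)).2] at q3
              exact q3
          · omega
      · rw [hk, opA_opA h1 h2]
      · obtain ⟨w1, w2, w3⟩ := opA_wt h1 h2 p l hp ha
        exact sdet_swap N _ _ ⟨l, by omega⟩ ⟨l + 1, hl⟩ rfl w1 w2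
          (fun i hi hi' => w3 i (fun h => hi (Fin.ext h)) (fun h => hi' (Fin.ext h)))
    · have hk : ∀ c, kop C (toLex (p, toLex (1, l))) c = opV C p l c := fun c => by
        simp [kop]
      obtain ⟨g1, g2, hD⟩ := opV_ok h1 h2 o1 o2 p l hl hp hv
        (fun p' hp' => hminV p' l hl (by omega) (Or.inl hp'))
        (hminA p l hl hp (Or.inr ⟨rfl, Or.inl (by omega)⟩))
      rw [hk]
      have ce1 : ∀ m, ∀ q ≤ p, (opV C p l c).1 m q = c.1 m q := fun m q hq => tail_left (by omega)
      have ce2 : ∀ m, ∀ q ≤ p, (opV C p l c).2 m q = c.2 m q := fun m q hq => tail_left (by omega)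
      refine ⟨(hS _).2 ⟨g1, g2⟩, ⟨hp, hl, Or.inr ⟨rfl, (V1_congr ce1 ce2).2 hv⟩⟩, ?_, ?_, ?_⟩
      · rintro n' hn' ⟨q1, q2, q3⟩
        obtain ⟨p', s', l', rfl⟩ : ∃ p s l, n' = toLex (p, toLex (s, l)) :=
          ⟨(ofLex n').1, (ofLex (ofLex n').2).1, (ofLex (ofLex n').2).2, rfl⟩
        have hn2 := (key_lt _ _ _ _ _ _).1 hn'
        simp only [ofLex_toLex] at q1 q2 q3
        have hpp : p' ≤ p := by omega
        apply hmin _ hn'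
        refine ⟨q1, q2, ?_⟩
        simp only [ofLex_toLex]
        rwa [A2_congr (fun m q hq => ce1 m q (by omega)) (fun m q hq => ce2 m q (by omega)),
          V1_congr (fun m q hq => ce1 m q (by omega)) (fun m q hq => ce2 m q (by omega))] at q3
      · rw [hk, opV_opV h1 h2]
      · obtain ⟨w1, w2, w3⟩ := opV_wt h1 h2 p l hp hD
        exact sdet_swap N _ _ ⟨l, by omega⟩ ⟨l + 1, hl⟩ rfl w1 w2
          (fun i hi hi' => w3 i (fun h => hi (Fin.ext h)) (fun h => hi' (Fin.ext h)))

end Okounkov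


namespace Okounkov

open Finset

/-- reachable cells -/
inductive Reach (mx mn : ℕ → ℕ → ℤ) (s : ℕ → ℕ → Prop) : ℕ → ℕ → Prop
  | seed (m c : ℕ) : s m c → mx m c ≠ mn m c → Reach mx mn s m c
  | right (m c : ℕ) : Reach mx mn s m c → mx m (c + 1) ≠ mn m (c + 1) → mn m (c + 1) < mx m c →
      Reach mx mn s m (c + 1)
  | left (m c : ℕ) : Reach mx mn s m (c + 1) → mx m c ≠ mn m c → mn m (c + 1) < mx m c →
      Reach mx mn s m c
  | up (m c : ℕ) : Reach mx mn s m c → mx (m + 1) c ≠ mn (m + 1) c → Reach mx mn s (m + 1) c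
  | down (m c : ℕ) : Reach mx mn s (m + 1) c → mx m c ≠ mn m c → Reach mx mn s m c

/-- reachable set of a pair -/
def WW (s : ℕ → ℕ → Prop) (c : PT) : ℕ → ℕ → Prop :=
  Reach (fun m q => max (c.1 m q) (c.2 m q)) (fun m q => min (c.1 m q) (c.2 m q)) s

open Classical in
/-- swap on a set of cells -/
noncomputable def sw (W : ℕ → ℕ → Prop) (c : PT) : PT :=
  (fun m q => if W m q then c.2 m q else c.1 m q, fun m q => if W m q then c.1 m q else c.2 m q)

theorem sw_sw (W : ℕ → ℕ → Prop) (c : PT) : sw W (sw W c) = c := by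
  unfold sw
  ext m q
  · simp only; split_ifs <;> rfl
  · simp only; split_ifs <;> rfl

theorem sw_pos {W : ℕ → ℕ → Prop} {c : PT} {m q : ℕ} (h : W m q) :
    (sw W c).1 m q = c.2 m q ∧ (sw W c).2 m q = c.1 m q := by
  simp [sw, h]

theorem sw_neg {W : ℕ → ℕ → Prop} {c : PT} {m q : ℕ} (h : ¬ W m q) :
    (sw W c).1 m q = c.1 m q ∧ (sw W c).2 m q = c.2 m q := by
  simp [sw, h]

theorem sw_add (W : ℕ → ℕ → Prop) (c : PT) (m q : ℕ) :
    (sw W c).1 m q + (sw W c).2 m q = c.1 m q + c.2 m q := by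
  by_cases h : W m q
  · rw [(sw_pos h).1, (sw_pos h).2, add_comm]
  · rw [(sw_neg h).1, (sw_neg h).2]

theorem WW_sw (s W : ℕ → ℕ → Prop) (c : PT) : WW s (sw W c) = WW s c := by
  unfold WW
  congr 1
  · funext m q
    by_cases h : W m q
    · rw [(sw_pos h).1, (sw_pos h).2, max_comm]
    · rw [(sw_neg h).1, (sw_neg h).2]
  · funext m q
    by_cases h : W m q
    · rw [(sw_pos h).1, (sw_pos h).2, min_comm]
    · rw [(sw_neg h).1, (sw_neg h).2]

/-- the injection -/
noncomputable def Phi (s : ℕ → ℕ → Prop) (c : PT) : PT := sw (WW s c) c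

theorem Phi_inj (s : ℕ → ℕ → Prop) : Function.Injective (Phi s) := by
  intro c d h
  have h1 : WW s (Phi s c) = WW s c := WW_sw _ _ _
  have h2 : WW s (Phi s d) = WW s d := WW_sw _ _ _
  have hc : sw (WW s c) (Phi s c) = c := sw_sw _ _
  have hd : sw (WW s d) (Phi s d) = d := sw_sw _ _
  rw [← hc, ← hd, ← h1, ← h2, h]

theorem DD_Phi (s : ℕ → ℕ → Prop) (c : PT) (l p : ℕ) : DD (Phi s c) l p = DD c l p := by
  unfold DD
  refine sum_congr rfl fun q _ => ?_
  have e1 := sw_add (WW s c) c l q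
  have e2 := sw_add (WW s c) c (l + 1) q
  have e3 := sw_add (WW s c) c (l + 2) q
  unfold dl Phi
  linarith

theorem wt2_Phi (s : ℕ → ℕ → Prop) (c : PT) (C l : ℕ) : wt2 C (Phi s c) l = wt2 C c l := by
  unfold wt2
  refine sum_congr rfl fun q _ => ?_
  have e1 := sw_add (WW s c) c l q
  have e2 := sw_add (WW s c) c (l + 1) q
  unfold Phi
  linarith

/-- seeds -/
def seedP (N : ℕ) (b1 t1 b2 t2 : ℕ → ℤ) (m c : ℕ) : Prop :=
  (m = 0 ∧ b1 c < b2 c) ∨ (N ≤ m ∧ t1 c < t2 c)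

section
variable {N : ℕ} {b1 t1 b2 t2 : ℕ → ℤ} {C : ℕ} {c : PT}

theorem WW_lt (h1 : Tab N b1 t1 c.1) (h2 : Tab N b2 t2 c.2) {m q : ℕ}
    (h : WW (seedP N b1 t1 b2 t2) c m q) : c.1 m q < c.2 m q := by
  unfold WW at h
  induction h with
  | seed m q hs _ =>
    rcases hs with ⟨rfl, hs⟩ | ⟨hm, hs⟩
    · rw [h1.bot, h2.bot]; exact hs
    · rw [h1.top m hm, h2.top m hm]; exact hs
  | right m q _ hne hlt ih =>
    have := h1.mono m q
    have := h2.mono m q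
    omega
  | left m q _ hne hlt ih =>
    have := h1.mono m q
    have := h2.mono m q
    omega
  | up m q _ hne ih =>
    have := h1.up1 m q
    have := h2.up m q
    omega
  | down m q _ hne ih =>
    have := h1.up m q
    have := h2.up1 m q
    omega

theorem Phi_tab (h1 : Tab N b1 t1 c.1) (h2 : Tab N b2 t2 c.2) :
    Tab N (fun q => max (b1 q) (b2 q)) (fun q => max (t1 q) (t2 q))
      (Phi (seedP N b1 t1 b2 t2) c).1 ∧
    Tab N (fun q => min (b1 q) (b2 q)) (fun q => min (t1 q) (t2 q))
      (Phi (seedP N b1 t1 b2 t2) c).2 := by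
  set W := WW (seedP N b1 t1 b2 t2) c with hW
  have hlt : ∀ m q, W m q → c.1 m q < c.2 m q := fun m q h => WW_lt h1 h2 h
  have hr : ∀ m q, W m q → ¬ W m (q + 1) → c.1 m (q + 1) = c.2 m (q + 1) ∨
      max (c.1 m q) (c.2 m q) ≤ min (c.1 m (q + 1)) (c.2 m (q + 1)) := by
    intro m q ha hb
    by_contra hh
    exact hb (Reach.right m q ha (by omega) (by omega))
  have hl : ∀ m q, W m (q + 1) → ¬ W m q → c.1 m q = c.2 m q ∨
      max (c.1 m q) (c.2 m q) ≤ min (c.1 m (q + 1)) (c.2 m (q + 1)) := by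
    intro m q ha hb
    by_contra hh
    exact hb (Reach.left m q ha (by omega) (by omega))
  have hu : ∀ m q, W m q → ¬ W (m + 1) q → c.1 (m + 1) q = c.2 (m + 1) q := by
    intro m q ha hb
    by_contra hh
    exact hb (Reach.up m q ha (by omega))
  have hd : ∀ m q, W (m + 1) q → ¬ W m q → c.1 m q = c.2 m q := by
    intro m q ha hb
    by_contra hh
    exact hb (Reach.down m q ha (by omega))
  have hval : ∀ m q, (W m q ∧ (sw W c).1 m q = c.2 m q ∧ (sw W c).2 m q = c.1 m q) ∨
      (¬ W m q ∧ (sw W c).1 m q = c.1 m q ∧ (sw W c).2 m q = c.2 m q) := by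
    intro m q
    by_cases h : W m q
    · exact Or.inl ⟨h, sw_pos h⟩
    · exact Or.inr ⟨h, sw_neg h⟩
  have hmono : ∀ m q, (sw W c).1 m q ≤ (sw W c).1 m (q + 1) ∧
      (sw W c).2 m q ≤ (sw W c).2 m (q + 1) := by
    intro m q
    have a1 := h1.mono m q
    have a2 := h2.mono m q
    have a3 := hr m q
    have a4 := hl m q
    rcases hval m q with ⟨hq, e1, e2⟩ | ⟨hq, e1, e2⟩ <;>
    rcases hval m (q + 1) with ⟨hq', e3, e4⟩ | ⟨hq', e3, e4⟩ <;>
    simp only [hq, hq', true_implies, not_true_eq_false, not_false_eq_true, false_implies] at a3 a4 <;>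
    omega
  have hup : ∀ m q, ((sw W c).1 m q ≤ (sw W c).1 (m + 1) q ∧
      (sw W c).2 m q ≤ (sw W c).2 (m + 1) q) ∧ ((sw W c).1 (m + 1) q ≤ (sw W c).1 m q + 1 ∧
      (sw W c).2 (m + 1) q ≤ (sw W c).2 m q + 1) := by
    intro m q
    have a1 := h1.up m q
    have a2 := h2.up m q
    have a5 := h1.up1 m q
    have a6 := h2.up1 m q
    have a3 := hu m q
    have a4 := hd m q
    rcases hval m q with ⟨hq, e1, e2⟩ | ⟨hq, e1, e2⟩ <;>
    rcases hval (m + 1) q with ⟨hq', e3, e4⟩ | ⟨hq', e3, e4⟩ <;>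
    simp only [hq, hq', true_implies, not_true_eq_false, not_false_eq_true, false_implies] at a3 a4 <;>
    omega
  have hbot : ∀ q, (sw W c).1 0 q = max (b1 q) (b2 q) ∧ (sw W c).2 0 q = min (b1 q) (b2 q) := by
    intro q
    have e1 := h1.bot q
    have e2 := h2.bot q
    rcases hval 0 q with ⟨hq, e3, e4⟩ | ⟨hq, e3, e4⟩
    · have := hlt _ _ hq
      omega
    · have : ¬ b1 q < b2 q := fun hh => hq (Reach.seed 0 q (Or.inl ⟨rfl, hh⟩) (by omega))
      omega
  have htop : ∀ m, N ≤ m → ∀ q, (sw W c).1 m q = max (t1 q) (t2 q) ∧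
      (sw W c).2 m q = min (t1 q) (t2 q) := by
    intro m hm q
    have e1 := h1.top m hm q
    have e2 := h2.top m hm q
    rcases hval m q with ⟨hq, e3, e4⟩ | ⟨hq, e3, e4⟩
    · have := hlt _ _ hq
      omega
    · have : ¬ t1 q < t2 q := fun hh => hq (Reach.seed m q (Or.inr ⟨hm, hh⟩) (by omega))
      omega
  exact ⟨⟨fun m q => (hmono m q).1, fun m q => (hup m q).1.1, fun m q => (hup m q).2.1,
      fun q => (hbot q).1, fun m hm q => (htop m hm q).1⟩,
    ⟨fun m q => (hmono m q).2, fun m q => (hup m q).1.2, fun m q => (hup m q).2.2,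
      fun q => (hbot q).2, fun m hm q => (htop m hm q).2⟩⟩

theorem Phi_A2 (h1 : Tab N b1 t1 c.1) (h2 : Tab N b2 t2 c.2) (p l : ℕ)
    (ha : A2 (Phi (seedP N b1 t1 b2 t2) c) p l) : A2 c p l := by
  obtain ⟨g1, g2⟩ := Phi_tab h1 h2
  have u1 := g1.bounds l p
  have u2 := g2.bounds l p
  unfold A2 at ha
  rw [DD_Phi] at ha
  set W := WW (seedP N b1 t1 b2 t2) c with hW
  have hP : Phi (seedP N b1 t1 b2 t2) c = sw W c := rfl
  rw [hP] at ha u1 u2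
  have hlt : ∀ m q, W m q → c.1 m q < c.2 m q := fun m q h => WW_lt h1 h2 h
  have hu : ∀ m q, W m q → ¬ W (m + 1) q → c.1 (m + 1) q = c.2 (m + 1) q := by
    intro m q ha hb
    by_contra hh
    exact hb (Reach.up m q ha (by omega))
  have hd : ∀ m q, W (m + 1) q → ¬ W m q → c.1 m q = c.2 m q := by
    intro m q ha hb
    by_contra hh
    exact hb (Reach.down m q ha (by omega))
  have hval : ∀ m q, (W m q ∧ (sw W c).1 m q = c.2 m q ∧ (sw W c).2 m q = c.1 m q ∧
      c.1 m q < c.2 m q) ∨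
      (¬ W m q ∧ (sw W c).1 m q = c.1 m q ∧ (sw W c).2 m q = c.2 m q) := by
    intro m q
    by_cases h : W m q
    · exact Or.inl ⟨h, (sw_pos h).1, (sw_pos h).2, hlt m q h⟩
    · exact Or.inr ⟨h, sw_neg h⟩
  unfold A2
  have a1 := hu l p
  have a2 := hd l p
  have a3 := hu (l + 1) p
  have a4 := hd (l + 1) p
  rw [show l + 1 + 1 = l + 2 by omega] at a3 a4
  rcases hval l p with ⟨q1, e1, e2⟩ | ⟨q1, e1, e2⟩ <;>
  rcases hval (l + 1) p with ⟨q2, e3, e4⟩ | ⟨q2, e3, e4⟩ <;>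
  rcases hval (l + 2) p with ⟨q3, e5, e6⟩ | ⟨q3, e5, e6⟩ <;>
  simp only [q1, q2, q3, true_implies, not_true_eq_false, not_false_eq_true, false_implies]
    at a1 a2 a3 a4 <;>
  omega

theorem Phi_NV (h1 : Tab N b1 t1 c.1) (h2 : Tab N b2 t2 c.2) (h : NV N C c) :
    NV N C (Phi (seedP N b1 t1 b2 t2) c) := by
  intro p hp l hl
  refine ⟨fun ha => (h p hp l hl).1 (Phi_A2 h1 h2 p l ha), ?_⟩
  unfold V1
  rw [DD_Phi]
  exact (h p hp l hl).2

end

end Okounkov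


namespace Okounkov

open Finset

theorem Tab.out {N k C : ℕ} {b t : ℕ → ℤ} {y : ℕ → ℕ → ℤ} (hb : IsCol k C b) (ht : IsCol k C t)
    (h : Tab N b t y) (m q : ℕ) (hq : C ≤ q) : y m q = k := by
  have hm : Monotone (fun m => y m q) := monotone_nat_of_le_succ (fun m => h.up m q)
  have h1 := hm (Nat.zero_le m)
  have h2 := hm (le_max_left m N)
  simp only at h1 h2
  rw [h.bot, hb.out q hq] at h1
  rw [h.top _ (le_max_right m N), ht.out q hq] at h2
  omega

theorem wt2_split (C : ℕ) (c : PT) (l : ℕ) : wt2 C c l =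
    ∑ q ∈ range C, (c.1 (l + 1) q - c.1 l q) + ∑ q ∈ range C, (c.2 (l + 1) q - c.2 l q) := by
  unfold wt2; rw [sum_add_distrib]

theorem Tab.sum_nonneg {N : ℕ} {b t : ℕ → ℤ} {y : ℕ → ℕ → ℤ} (h : Tab N b t y) (C l : ℕ) :
    0 ≤ ∑ q ∈ range C, (y (l + 1) q - y l q) :=
  Finset.sum_nonneg fun q _ => by have := h.up l q; omega

theorem wgt_mul (N C : ℕ) {b1 t1 b2 t2 : ℕ → ℤ} (c : PT) (h1 : Tab N b1 t1 c.1)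
    (h2 : Tab N b2 t2 c.2) : wgt (xx N) C N c.1 * wgt (xx N) C N c.2 =
      ∏ i : Fin N, (MvPolynomial.X i : MvPolynomial (Fin N) ℤ) ^ (wt2 C c i).toNat := by
  unfold wgt
  rw [← prod_mul_distrib, ← Fin.prod_univ_eq_prod_range
    (fun l => xx N l ^ (∑ q ∈ range C, (c.1 (l + 1) q - c.1 l q)).toNat *
      xx N l ^ (∑ q ∈ range C, (c.2 (l + 1) q - c.2 l q)).toNat) N]
  refine prod_congr rfl fun i _ => ?_
  rw [← pow_add, xx_fin, wt2_split, Int.toNat_add (h1.sum_nonneg C i) (h2.sum_nonneg C i)]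

theorem wt2_nonneg (N C : ℕ) {b1 t1 b2 t2 : ℕ → ℤ} (c : PT) (h1 : Tab N b1 t1 c.1)
    (h2 : Tab N b2 t2 c.2) (l : ℕ) : 0 ≤ wt2 C c l := by
  rw [wt2_split]
  exact add_nonneg (h1.sum_nonneg C l) (h2.sum_nonneg C l)

theorem wt2_zero (N C : ℕ) {b1 t1 b2 t2 : ℕ → ℤ} (c : PT) (h1 : Tab N b1 t1 c.1)
    (h2 : Tab N b2 t2 c.2) (l : ℕ) (hl : N ≤ l) : wt2 C c l = 0 := by
  unfold wt2
  refine sum_eq_zero fun q _ => ?_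
  rw [h1.top l hl, h2.top l hl, h1.top _ (by omega), h2.top _ (by omega)]
  ring

theorem wt2_diff (C : ℕ) (c : PT) (l : ℕ) : wt2 C c (l + 1) - wt2 C c l = DD c l C := by
  unfold wt2 DD dl
  rw [← sum_sub_distrib]
  refine sum_congr rfl fun q _ => ?_
  ring

theorem wt2_antitone (N C : ℕ) {b1 t1 b2 t2 : ℕ → ℤ} (c : PT) (h1 : Tab N b1 t1 c.1)
    (h2 : Tab N b2 t2 c.2) (h : NV N C c) : Antitone (fun l => (wt2 C c l).toNat) := by
  refine antitone_nat_of_succ_le fun l => ?_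
  refine Int.toNat_le_toNat ?_
  by_cases hl : l + 1 < N
  · have hd := wt2_diff C c l
    have : DD c l C ≤ 0 := by
      rcases C with _ | C
      · simp [DD]
      · have := (h C (by omega) l hl).2
        unfold V1 at this
        omega
    omega
  · rw [wt2_zero N C c h1 h2 (l + 1) (by omega)]
    exact wt2_nonneg N C c h1 h2 l

theorem nonneg_zero (N : ℕ) : IsSchurNonneg N 0 :=
  ⟨0, Fin.elim0, Fin.elim0, Fin.elim0, fun i => i.elim0, fun i => i.elim0, by simp⟩

theorem nonneg_single (N k : ℕ) (lam : ℕ → ℕ) (h : Antitone lam) (h0 : ∀ j, k ≤ j → lam j = 0) :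
    IsSchurNonneg N (skewSchur N k lam (fun _ => 0)) :=
  ⟨1, fun _ => 1, fun _ => k, fun _ => lam, fun _ => h, fun _ => h0, by simp⟩

theorem nonneg_add {N : ℕ} {f g : MvPolynomial (Fin N) ℤ} (hf : IsSchurNonneg N f)
    (hg : IsSchurNonneg N g) : IsSchurNonneg N (f + g) := by
  obtain ⟨m, c, k, l, h1, h2, h3⟩ := hf
  obtain ⟨m', c', k', l', h1', h2', h3'⟩ := hg
  refine ⟨m + m', Fin.append c c', Fin.append k k', Fin.append l l', ?_, ?_, ?_⟩
  · intro i
    refine Fin.addCases (fun i => ?_) (fun i => ?_) i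
    · rw [Fin.append_left]; exact h1 i
    · rw [Fin.append_right]; exact h1' i
  · intro i
    refine Fin.addCases (fun i => ?_) (fun i => ?_) i
    · rw [Fin.append_left, Fin.append_left]; exact h2 i
    · rw [Fin.append_right, Fin.append_right]; exact h2' i
  · rw [Fin.sum_univ_add, h3, h3']
    simp only [Fin.append_left, Fin.append_right]

theorem nonneg_sum {ι : Type*} {N : ℕ} (S : Finset ι) (f : ι → MvPolynomial (Fin N) ℤ)
    (h : ∀ i ∈ S, IsSchurNonneg N (f i)) : IsSchurNonneg N (∑ i ∈ S, f i) := by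
  classical
  induction S using Finset.induction_on with
  | empty => simpa using nonneg_zero N
  | insert a s ha ih =>
    rw [sum_insert ha]
    exact nonneg_add (h a (mem_insert_self a s)) (ih fun i hi => h i (mem_insert_of_mem hi))

theorem prod_expand (N K C : ℕ) (lam mu nu rho : ℕ → ℕ) (hl : Antitone lam) (hm : Antitone mu)
    (hn : Antitone nu) (hr : Antitone rho) (hlC : ∀ i, lam i ≤ C) (hmC : ∀ i, mu i ≤ C)
    (hnC : ∀ i, nu i ≤ C) (hrC : ∀ i, rho i ≤ C) [DecidablePred (NV N C)] :
    ∃ S : Finset PT, (∀ c, c ∈ S ↔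
      Tab N (colsL (K + 1) C mu) (colsL (K + 1) C lam) c.1 ∧
      Tab N (colsL (K + 1) C rho) (colsL (K + 1) C nu) c.2) ∧
      skewSchur N (K + 1) lam mu * skewSchur N (K + 1) nu rho =
        ∑ c ∈ S with NV N C c, sdet N (fun i => wt2 C c i) := by
  obtain ⟨S1, hS1, e1⟩ := skewSchur_sum N K C lam mu hl hm hlC hmC
  obtain ⟨S2, hS2, e2⟩ := skewSchur_sum N K C nu rho hn hr hnC hrC
  have hS : ∀ c : PT, c ∈ S1 ×ˢ S2 ↔
      Tab N (colsL (K + 1) C mu) (colsL (K + 1) C lam) c.1 ∧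
      Tab N (colsL (K + 1) C rho) (colsL (K + 1) C nu) c.2 := by
    intro c
    rw [mem_product, hS1, hS2]
  refine ⟨S1 ×ˢ S2, hS, ?_⟩
  have hsym : (skewSchur N (K + 1) lam mu * skewSchur N (K + 1) nu rho).IsSymmetric :=
    (det_homog_symm N (K + 1) _).mul (det_homog_symm N (K + 1) _)
  have hF : skewSchur N (K + 1) lam mu * skewSchur N (K + 1) nu rho =
      ∑ c ∈ S1 ×ˢ S2, ∏ i : Fin N, (MvPolynomial.X i : MvPolynomial (Fin N) ℤ) ^
        (wt2 C c i).toNat := by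
    rw [e1, e2, sum_mul_sum, ← sum_product']
    refine sum_congr rfl fun c hc => ?_
    obtain ⟨h1, h2⟩ := (hS c).1 hc
    exact wgt_mul N C c h1 h2
  rw [expand N _ (fun c i => (wt2 C c i).toNat) _ hsym hF,
    ← cancel N C ((K + 1 : ℕ) : ℤ) _ _ _ _ _ hS]
  · refine sum_congr rfl fun c hc => ?_
    obtain ⟨h1, h2⟩ := (hS c).1 hc
    congr 1
    funext i
    exact Int.toNat_of_nonneg (wt2_nonneg N C c h1 h2 i)
  · intro c hc
    obtain ⟨h1, h2⟩ := (hS c).1 hc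
    exact ⟨fun m q hq => h1.out (colsL_isCol _ _ _) (colsL_isCol _ _ _) m q hq,
      fun m q hq => h2.out (colsL_isCol _ _ _) (colsL_isCol _ _ _) m q hq⟩

theorem sdet_nonneg (N C : ℕ) {b1 t1 b2 t2 : ℕ → ℤ} (c : PT) (h1 : Tab N b1 t1 c.1)
    (h2 : Tab N b2 t2 c.2) (h : NV N C c) : IsSchurNonneg N (sdet N (fun i => wt2 C c i)) := by
  have e : sdet N (fun i => wt2 C c i) =
      skewSchur N N (fun l => (wt2 C c l).toNat) (fun _ => 0) := by
    unfold sdet skewSchur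
    congr 2
    ext1 i; ext1 j
    rw [homog_eq, Int.toNat_of_nonneg (wt2_nonneg N C c h1 h2 i)]
    simp
  rw [e]
  refine nonneg_single N N _ (wt2_antitone N C c h1 h2 h) fun j hj => ?_
  rw [wt2_zero N C c h1 h2 j hj]; rfl

theorem meet_join (N K : ℕ) (lam mu nu rho : ℕ → ℕ) (hl : Antitone lam) (hm : Antitone mu)
    (hn : Antitone nu) (hr : Antitone rho) :
    IsSchurNonneg N (skewSchur N (K + 1) (fun i => min (lam i) (nu i)) (fun i => min (mu i) (rho i))
      * skewSchur N (K + 1) (fun i => max (lam i) (nu i)) (fun i => max (mu i) (rho i))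
      - skewSchur N (K + 1) lam mu * skewSchur N (K + 1) nu rho) := by
  classical
  set C := lam 0 + mu 0 + nu 0 + rho 0 with hC
  have bl : ∀ i, lam i ≤ C := fun i => by have := hl (Nat.zero_le i); omega
  have bm : ∀ i, mu i ≤ C := fun i => by have := hm (Nat.zero_le i); omega
  have bn : ∀ i, nu i ≤ C := fun i => by have := hn (Nat.zero_le i); omega
  have br : ∀ i, rho i ≤ C := fun i => by have := hr (Nat.zero_le i); omega
  have amx : ∀ {f g : ℕ → ℕ}, Antitone f → Antitone g → Antitone fun i => max (f i) (g i) :=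
    fun hf hg a b hab => max_le_max (hf hab) (hg hab)
  have amn : ∀ {f g : ℕ → ℕ}, Antitone f → Antitone g → Antitone fun i => min (f i) (g i) :=
    fun hf hg a b hab => min_le_min (hf hab) (hg hab)
  obtain ⟨S, hS, eS⟩ := prod_expand N K C lam mu nu rho hl hm hn hr bl bm bn br
  obtain ⟨T, hT, eT⟩ := prod_expand N K C (fun i => max (lam i) (nu i)) (fun i => max (mu i) (rho i))
    (fun i => min (lam i) (nu i)) (fun i => min (mu i) (rho i)) (amx hl hn) (amx hm hr)
    (amn hl hn) (amn hm hr) (fun i => max_le (bl i) (bn i)) (fun i => max_le (bm i) (br i))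
    (fun i => (min_le_left _ _).trans (bl i)) (fun i => (min_le_left _ _).trans (bm i))
  rw [mul_comm (skewSchur N (K + 1) (fun i => min (lam i) (nu i)) _), eS, eT]
  set P := Phi (seedP N (colsL (K + 1) C mu) (colsL (K + 1) C lam) (colsL (K + 1) C rho)
    (colsL (K + 1) C nu))
  have him : (S.filter (NV N C)).image P ⊆ T.filter (NV N C) := by
    intro d hd
    obtain ⟨c, hc, rfl⟩ := mem_image.1 hd
    obtain ⟨hc1, hc2⟩ := mem_filter.1 hc
    obtain ⟨h1, h2⟩ := (hS c).1 hc1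
    refine mem_filter.2 ⟨(hT _).2 ?_, Phi_NV h1 h2 hc2⟩
    rw [colsL_max hl hn, colsL_max hm hr, colsL_min hl hn, colsL_min hm hr]
    exact Phi_tab h1 h2
  have e : ∑ c ∈ S with NV N C c, sdet N (fun i => wt2 C c i) =
      ∑ c ∈ (S.filter (NV N C)).image P, sdet N (fun i => wt2 C c i) := by
    rw [sum_image (fun a _ b _ hab => Phi_inj _ hab)]
    refine sum_congr rfl fun c _ => ?_
    simp only [wt2_Phi]
  rw [e, ← sum_sdiff him, add_sub_cancel_right]
  refine nonneg_sum _ _ fun c hc => ?_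
  obtain ⟨hc1, hc2⟩ := mem_filter.1 (mem_sdiff.1 hc).1
  obtain ⟨h1, h2⟩ := (hT c).1 hc1
  exact sdet_nonneg N C c h1 h2 hc2

end Okounkov


namespace Okounkov

open Finset

theorem skewSchur_shift (N k c : ℕ) (lam mu : ℕ → ℕ) :
    skewSchur N k (fun i => lam i + c) (fun i => mu i + c) = skewSchur N k lam mu := by
  unfold skewSchur
  congr 2
  ext1 i; ext1 j
  congr 1
  push_cast
  ring

theorem reflect (N K : ℕ) (B : ℕ) : ∀ (lam mu nu rho : ℕ → ℕ), Antitone lam → Antitone mu →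
    Antitone nu → Antitone rho → (∀ i, nu i ≤ lam i ∧ lam i ≤ nu i + B) →
    (∀ i, rho i ≤ mu i ∧ mu i ≤ rho i + B) → (∀ i, 2 ∣ lam i + nu i) → (∀ i, 2 ∣ mu i + rho i) →
    IsSchurNonneg N
      ((skewSchur N (K + 1) (fun i => (lam i + nu i) / 2) (fun i => (mu i + rho i) / 2)) ^ 2
        - skewSchur N (K + 1) lam mu * skewSchur N (K + 1) nu rho) := by
  induction B using Nat.strong_induction_on with
  | _ B ih =>
  intro lam mu nu rho hl hm hn hr h1 h2 e1 e2
  by_cases hB : B ≤ 1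
  · have a1 : lam = nu := by
      funext i; have := h1 i; have := e1 i; omega
    have a2 : mu = rho := by
      funext i; have := h2 i; have := e2 i; omega
    subst a1 a2
    have b1 : (fun i => (lam i + lam i) / 2) = lam := by funext i; omega
    have b2 : (fun i => (mu i + mu i) / 2) = mu := by funext i; omega
    rw [b1, b2, ← sq, sub_self]
    exact nonneg_zero N
  · set c := (B + 1) / 2 with hc
    have hcn : Antitone fun i => nu i + c := fun a b hab => by have := hn hab; simp only; omega
    have hcr : Antitone fun i => rho i + c := fun a b hab => by have := hr hab; simp only; omega
    have mj := meet_join N K lam mu (fun i => nu i + c) (fun i => rho i + c) hl hm hcn hcr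
    have s1 : (fun i => max (lam i) (nu i + c)) = fun i => max (lam i - c) (nu i) + c := by
      funext i; omega
    have s2 : (fun i => max (mu i) (rho i + c)) = fun i => max (mu i - c) (rho i) + c := by
      funext i; omega
    rw [s1, s2, skewSchur_shift, skewSchur_shift] at mj
    have key := ih c (by omega) (fun i => min (lam i) (nu i + c)) (fun i => min (mu i) (rho i + c))
      (fun i => max (lam i - c) (nu i)) (fun i => max (mu i - c) (rho i))
      (fun a b hab => by have := hl hab; have := hn hab; simp only; omega)
      (fun a b hab => by have := hm hab; have := hr hab; simp only; omega)
      (fun a b hab => by have := hl hab; have := hn hab; simp only; omega)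
      (fun a b hab => by have := hm hab; have := hr hab; simp only; omega)
      (fun i => by have := h1 i; omega)
      (fun i => by have := h2 i; omega)
      (fun i => by have := h1 i; have := e1 i; omega)
      (fun i => by have := h2 i; have := e2 i; omega)
    have q1 : (fun i => (min (lam i) (nu i + c) + max (lam i - c) (nu i)) / 2) =
        fun i => (lam i + nu i) / 2 := by funext i; congr 1; omega
    have q2 : (fun i => (min (mu i) (rho i + c) + max (mu i - c) (rho i)) / 2) =
        fun i => (mu i + rho i) / 2 := by funext i; congr 1; omega
    rw [q1, q2] at key
    have := nonneg_add key mj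
    rwa [sub_add_sub_cancel] at this

theorem main (N K : ℕ) (lam mu nu rho : ℕ → ℕ) (hl : Antitone lam) (hm : Antitone mu)
    (hn : Antitone nu) (hr : Antitone rho) (e1 : ∀ i, 2 ∣ lam i + nu i)
    (e2 : ∀ i, 2 ∣ mu i + rho i) :
    IsSchurNonneg N
      ((skewSchur N (K + 1) (fun i => (lam i + nu i) / 2) (fun i => (mu i + rho i) / 2)) ^ 2
        - skewSchur N (K + 1) lam mu * skewSchur N (K + 1) nu rho) := by
  have mj := meet_join N K lam mu nu rho hl hm hn hr
  have key := reflect N K (lam 0 + mu 0 + nu 0 + rho 0)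
      (fun i => max (lam i) (nu i)) (fun i => max (mu i) (rho i))
      (fun i => min (lam i) (nu i)) (fun i => min (mu i) (rho i))
      (fun a b hab => by have := hl hab; have := hn hab; simp only; omega)
      (fun a b hab => by have := hm hab; have := hr hab; simp only; omega)
      (fun a b hab => by have := hl hab; have := hn hab; simp only; omega)
      (fun a b hab => by have := hm hab; have := hr hab; simp only; omega)
      (fun i => by have := hl (Nat.zero_le i); have := hn (Nat.zero_le i); omega)
      (fun i => by have := hm (Nat.zero_le i); have := hr (Nat.zero_le i); omega)
      (fun i => by have := e1 i; omega)
      (fun i => by have := e2 i; omega)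
  have q1 : (fun i => (max (lam i) (nu i) + min (lam i) (nu i)) / 2) =
      fun i => (lam i + nu i) / 2 := by funext i; congr 1; omega
  have q2 : (fun i => (max (mu i) (rho i) + min (mu i) (rho i)) / 2) =
      fun i => (mu i + rho i) / 2 := by funext i; congr 1; omega
  rw [q1, q2, mul_comm (skewSchur N (K + 1) (fun i => max (lam i) (nu i)) _)] at key
  have := nonneg_add key mj
  rwa [sub_add_sub_cancel] at this

end Okounkov

/-- **Okounkov's conjecture.** For skew shapes `λ/μ` and `ν/ρ` such that `λ+ν`
and `μ+ρ` have all even parts, `(s_{((λ+ν)/2)/((μ+ρ)/2)})² ≥_s s_{λ/μ} s_{ν/ρ}`. -/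
theorem okounkov_conjecture (k : ℕ) (lam mu nu rho : ℕ → ℕ)
    (hlam : Antitone lam) (hmu : Antitone mu) (hnu : Antitone nu) (hrho : Antitone rho)
    (hlamk : ∀ j, k ≤ j → lam j = 0) (hmuk : ∀ j, k ≤ j → mu j = 0)
    (hnuk : ∀ j, k ≤ j → nu j = 0) (hrhok : ∀ j, k ≤ j → rho j = 0)
    (hml : ∀ i, mu i ≤ lam i) (hrn : ∀ i, rho i ≤ nu i)
    (heven₁ : ∀ i, 2 ∣ lam i + nu i) (heven₂ : ∀ i, 2 ∣ mu i + rho i)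
    (N : ℕ) :
    IsSchurNonneg N
      ((skewSchur N k (fun i => (lam i + nu i) / 2) (fun i => (mu i + rho i) / 2)) ^ 2
        - skewSchur N k lam mu * skewSchur N k nu rho) := by
  rcases k with _ | K
  · simp only [skewSchur, Matrix.det_isEmpty]
    simpa using Okounkov.nonneg_zero N
  · exact Okounkov.main N K lam mu nu rho hlam hmu hnu hrho heven₁ heven₂
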